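/- arXiv:2304.06609 — 4 statements merged into one kernel-verified Lean document; each statement's English description precedes it below -/
import Mathlib

section
/- Let M be a sequentially Cohen-Macaulay module over R with sCM filtration 0 = M_0 ⊊ M_1 ⊊ … ⊊ M_r = M, and set d_i = dim(M_i/M_{i-1}) for i = 1,…,r. Then for every integer j, the local cohomology module H^j_m(M) is nonzero if and only if j ∈ {d_1,…,d_r}, and for each i there are isomorphisms H^{d_i}_m(M) ≅ H^{d_i}_m(M_i) ≅ H^{d_i}_m(M_i/M_{i-1}). -/
open CategoryTheory

noncomputable section

/-- The (Krull) dimension of a module: the Krull dimension of its support.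
The dimension of the zero module is `⊥` (thought of as `-1`). -/
noncomputable def mDim (R : Type) [CommRing R] (M : Type) [AddCommGroup M] [Module R M] :
    WithBot ℕ∞ :=
  Order.krullDim (Module.support R M)

/-- The `i`-th Ext module `Ext_R^i(A, B)` (as a type). -/
noncomputable abbrev extC (R : Type) [CommRing R] (i : ℕ) (A B : Type)
    [AddCommGroup A] [Module R A] [AddCommGroup B] [Module R B] : Type :=
  ↥(((Ext R (ModuleCat R) i).obj (Opposite.op (ModuleCat.of R A))).obj (ModuleCat.of R B))

/-- The depth of a module `M` with respect to an ideal `I`: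
the least `i` such that `Ext_R^i(R/I, M) ≠ 0` (and `⊤` if there is no such `i`,
in particular the depth of the zero module is `⊤ = +∞`). -/
noncomputable def mDepth (R : Type) [CommRing R] (I : Ideal R) (M : Type)
    [AddCommGroup M] [Module R M] : ℕ∞ :=
  sInf {i : ℕ∞ | ∃ j : ℕ, i = j ∧ Nontrivial (extC R j (R ⧸ I) M)}

/-- `M` is a Cohen-Macaulay module (with respect to the (maximal) ideal `I`) if it is
nonzero and its depth equals its dimension. -/
def IsCM (R : Type) [CommRing R] (I : Ideal R) (M : Type) [AddCommGroup M] [Module R M] :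
    Prop :=
  Nontrivial M ∧ (mDepth R I M : WithBot ℕ∞) = mDim R M

/-- The subquotient `N'/N` of a module (most meaningful when `N ≤ N'`). -/
abbrev subQuot (R : Type) [CommRing R] {M : Type} [AddCommGroup M] [Module R M]
    (N N' : Submodule R M) : Type :=
  N' ⧸ (Submodule.comap N'.subtype N)

/-- `F 0 = 0 ⊊ F 1 ⊊ ⋯ ⊊ F r = M` is a sCM filtration: each quotient `F (i+1) / F i`
is Cohen-Macaulay and the dimensions of the quotients are strictly increasing. -/
def IsSCMFil (R : Type) [CommRing R] (I : Ideal R) {M : Type} [AddCommGroup M] [Module R M]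
    (r : ℕ) (F : ℕ → Submodule R M) : Prop :=
  F 0 = ⊥ ∧ F r = ⊤ ∧ (∀ i < r, F i < F (i + 1)) ∧
    (∀ i < r, IsCM R I (subQuot R (F i) (F (i + 1)))) ∧
    (∀ i, i + 1 < r →
      mDim R (subQuot R (F i) (F (i + 1))) < mDim R (subQuot R (F (i + 1)) (F (i + 2))))

/-- `M` is sequentially Cohen-Macaulay if it admits a sCM filtration. -/
def IsSeqCM (R : Type) [CommRing R] (I : Ideal R) (M : Type) [AddCommGroup M] [Module R M] :
    Prop :=
  ∃ (r : ℕ) (F : ℕ → Submodule R M), IsSCMFil R I r F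

/-- `δ_c(M)`: the largest submodule of `M` of dimension at most `c`. -/
noncomputable def deltaSub (R : Type) [CommRing R] (M : Type) [AddCommGroup M] [Module R M]
    (c : ℕ) : Submodule R M :=
  sSup {N : Submodule R M | mDim R ↥N ≤ (c : WithBot ℕ∞)}

/-- `δ_{c-1}(M)`, with `δ_{-1}(M) = 0`. -/
noncomputable def deltaSubPred (R : Type) [CommRing R] (M : Type) [AddCommGroup M] [Module R M] :
    ℕ → Submodule R M
  | 0 => ⊥
  | (c + 1) => deltaSub R M c

/-- `H^0_I(M)`, the `I`-power-torsion submodule of `M`. -/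
noncomputable def tors (R : Type) [CommRing R] (I : Ideal R) (M : Type) [AddCommGroup M]
    [Module R M] : Submodule R M :=
  ⨆ t : ℕ, Submodule.torsionBySet R M ((I ^ t : Ideal R) : Set R)

end
section
open CategoryTheory Limits Opposite

section
variable {C : Type*} [Category C] [Abelian C]
lemma sc_kill (S : ShortComplex C) {A : C} [Injective A] (k : S.X₂ ⟶ A) (hk : S.f ≫ k = 0) :
    S.homologyι ≫ S.descOpcycles k hk = 0 ↔ ∃ l : S.X₃ ⟶ A, S.g ≫ l = k := by
  constructor
  · intro h
    let T : ShortComplex C := ShortComplex.mk S.homologyι S.fromOpcycles (by simp)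
    have hT : T.Exact := ShortComplex.exact_of_f_is_kernel _ S.homologyIsKernel
    refine ⟨hT.descToInjective (S.descOpcycles k hk) h, ?_⟩
    have := hT.comp_descToInjective (S.descOpcycles k hk) h
    have h2 := congrArg (fun t => S.pOpcycles ≫ t) this
    simpa [T] using h2
  · rintro ⟨l, rfl⟩
    have : S.descOpcycles (S.g ≫ l) hk = S.fromOpcycles ≫ l := by
      rw [← cancel_epi S.pOpcycles]; simp
    rw [this]; simp
lemma sc_surj (S : ShortComplex C) {A : C} [Injective A] (a : S.homology ⟶ A) :
    ∃ (k : S.X₂ ⟶ A) (hk : S.f ≫ k = 0), S.homologyι ≫ S.descOpcycles k hk = a := by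
  refine ⟨S.pOpcycles ≫ Injective.factorThru a S.homologyι, by simp, ?_⟩
  have : S.descOpcycles (S.pOpcycles ≫ Injective.factorThru a S.homologyι) (by simp) =
     Injective.factorThru a S.homologyι := by
    rw [← cancel_epi S.pOpcycles]; simp
  rw [this]; simp
end

variable {R : Type} [CommRing R]
section
variable (R) in
abbrev FF (Y : ModuleCat.{0} R) : ModuleCat.{0} R ⥤ (ModuleCat.{0} R)ᵒᵖ :=
  ((linearYoneda R (ModuleCat.{0} R)).obj Y).rightOp

noncomputable abbrev KK {X : ModuleCat.{0} R} (P : ProjectiveResolution X) (Y : ModuleCat.{0} R) :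
    ChainComplex (ModuleCat.{0} R)ᵒᵖ ℕ :=
  ((FF R Y).mapHomologicalComplex _).obj P.complex

variable (R) in
abbrev RR : (ModuleCat.{0} R)ᵒᵖ := op (ModuleCat.of R R)

variable (R) in
instance RR_inj : Injective (RR R) := by
  unfold RR
  infer_instance

noncomputable def kk {X Y : ModuleCat.{0} R} (f : X ⟶ Y) :
   (FF R Y).obj X ⟶ RR R :=
  (ModuleCat.ofHom (LinearMap.toSpanSingleton R (X ⟶ Y) f)).op

lemma kk_ext {X Y : ModuleCat.{0} R} {a b : (FF R Y).obj X ⟶ RR R}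
    (h : (a.unop.hom (1 : R) : X ⟶ Y) = b.unop.hom (1 : R)) : a = b := by
  apply Quiver.Hom.unop_inj
  ext
  exact h

lemma kk_one {X Y : ModuleCat.{0} R} (f : X ⟶ Y) : ((kk f).unop.hom (1 : R) : X ⟶ Y) = f :=
  one_smul R f

lemma map_kk {X X' Y : ModuleCat.{0} R} (g : X' ⟶ X) (f : X ⟶ Y) :
    (FF R Y).map g ≫ kk f = kk (g ≫ f) := by
  apply kk_ext
  rw [kk_one]
  change g ≫ (kk f).unop.hom (1 : R) = _
  rw [kk_one]

lemma natTrans_kk {X Y Y' : ModuleCat.{0} R} (f : X ⟶ Y) (g : Y ⟶ Y') :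
    (NatTrans.rightOp ((linearYoneda R (ModuleCat.{0} R)).map g)).app X ≫ kk f = kk (f ≫ g) := by
  apply kk_ext
  rw [kk_one]
  change (kk f).unop.hom (1 : R) ≫ g = _
  rw [kk_one]

lemma kk_surj {X Y : ModuleCat.{0} R} (a : (FF R Y).obj X ⟶ RR R) : ∃ f, kk f = a :=
  ⟨a.unop.hom (1 : R), kk_ext (kk_one _)⟩

lemma kk_inj {X Y : ModuleCat.{0} R} {f g : X ⟶ Y} (h : kk f = kk g) : f = g := by
  rw [← kk_one f, h, kk_one]

lemma kk_add {X Y : ModuleCat.{0} R} (f g : X ⟶ Y) : kk (f + g) = kk f + kk g := by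
  apply kk_ext
  rw [kk_one]
  change _ = (kk f).unop.hom (1 : R) + (kk g).unop.hom (1 : R)
  exact (congrArg₂ (fun (a b : X ⟶ Y) => a + b) (kk_one f) (kk_one g)).symm

lemma kk_zero {X Y : ModuleCat.{0} R} : kk (0 : X ⟶ Y) = 0 := by
  apply kk_ext
  rw [kk_one]
  rfl
end

section
variable {C : Type*} [Category C] [Abelian C] {ι : Type*} {c : ComplexShape ι}
lemma hι_desc_add (K : HomologicalComplex C c) {i j : ι} {A : C} (hj : c.prev i = j)
    (k l m : K.X i ⟶ A) (hm : m = k + l)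
    (hk : K.d j i ≫ k = 0) (hl : K.d j i ≫ l = 0) (hm' : K.d j i ≫ m = 0) :
    K.homologyι i ≫ K.descOpcycles m j hj hm' =
      K.homologyι i ≫ K.descOpcycles k j hj hk + K.homologyι i ≫ K.descOpcycles l j hj hl := by
  subst hm
  rw [← Preadditive.comp_add]
  congr 1
  rw [← cancel_epi (K.pOpcycles i)]
  simp
lemma hι_desc_nat {K L : HomologicalComplex C c} (φ : K ⟶ L) {i j : ι} {A : C} (hj : c.prev i = j)
    (k : L.X i ⟶ A) (m : K.X i ⟶ A) (hm : φ.f i ≫ k = m)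
    (hk : L.d j i ≫ k = 0) (hm' : K.d j i ≫ m = 0) :
    HomologicalComplex.homologyMap φ i ≫ L.homologyι i ≫ L.descOpcycles k j hj hk =
      K.homologyι i ≫ K.descOpcycles m j hj hm' := by
  subst hm
  rw [HomologicalComplex.homologyι_naturality_assoc]
  congr 1
  rw [← cancel_epi (K.pOpcycles i)]
  simp
lemma comp_add_aux {X Y Z : C} (e : X ⟶ Y) {a b d : Y ⟶ Z} (h : d = a + b) :
    e ≫ d = e ≫ a + e ≫ b := by rw [h, Preadditive.comp_add]
end


section
variable {X X' Y Y' : ModuleCat.{0} R}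

lemma kk_cocycle (P : ProjectiveResolution X) {n m : ℕ} {f : P.complex.X n ⟶ Y}
    (hf : P.complex.d m n ≫ f = 0) : (KK P Y).d m n ≫ kk f = 0 := by
  have := map_kk (P.complex.d m n) f
  rw [hf, kk_zero] at this
  exact this

noncomputable def oldHom (P : ProjectiveResolution X) {n : ℕ} (f : P.complex.X n ⟶ Y)
    (hf : P.complex.d (n+1) n ≫ f = 0) : ((FF R Y).leftDerived n).obj X ⟶ RR R :=
  (P.isoLeftDerivedObj (FF R Y) n).hom ≫ (KK P Y).homologyι n ≫
    (KK P Y).descOpcycles (kk f) (n+1) (by simp) (kk_cocycle P hf)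

lemma oldHom_add (P : ProjectiveResolution X) {n : ℕ} (f g : P.complex.X n ⟶ Y)
    (hf : P.complex.d (n+1) n ≫ f = 0) (hg : P.complex.d (n+1) n ≫ g = 0) :
    oldHom P (f + g) (by simp [hf, hg]) = oldHom P f hf + oldHom P g hg := by
  exact comp_add_aux _ (hι_desc_add (KK P Y) (by simp) (kk f) (kk g) (kk (f+g)) (kk_add f g)
    (kk_cocycle P hf) (kk_cocycle P hg) (kk_cocycle P (by simp [hf, hg])))

lemma oldHom_surj (P : ProjectiveResolution X) {n : ℕ}
    (a : ((FF R Y).leftDerived n).obj X ⟶ RR R) :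
    ∃ (f : P.complex.X n ⟶ Y) (hf : P.complex.d (n+1) n ≫ f = 0), oldHom P f hf = a := by
  let b : (KK P Y).homology n ⟶ RR R := (P.isoLeftDerivedObj (FF R Y) n).inv ≫ a
  obtain ⟨k, hk, h⟩ := sc_surj ((KK P Y).sc n) b
  obtain ⟨f, rfl⟩ := kk_surj (X := P.complex.X n) (Y := Y) k
  have hf : P.complex.d (n+1) n ≫ f = 0 := by
    apply kk_inj
    rw [kk_zero, ← map_kk]
    have : ((ComplexShape.down ℕ).prev n) = n + 1 := by simp
    have h2 : (KK P Y).d ((ComplexShape.down ℕ).prev n) n ≫ kk f = 0 := hk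
    rw [this] at h2
    exact h2
  refine ⟨f, hf, ?_⟩
  unfold oldHom
  rw [← Iso.eq_inv_comp]
  exact h

lemma oldHom_eq_zero_iff (P : ProjectiveResolution X) {n : ℕ} (f : P.complex.X n ⟶ Y)
    (hf : P.complex.d (n+1) n ≫ f = 0) :
    oldHom P f hf = 0 ↔ ∃ g : P.complex.X ((ComplexShape.down ℕ).next n) ⟶ Y,
      P.complex.d n ((ComplexShape.down ℕ).next n) ≫ g = f := by
  unfold oldHom
  rw [Preadditive.IsIso.comp_left_eq_zero]
  have hk : ((KK P Y).sc n).f ≫ kk f = 0 := by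
    have : ((ComplexShape.down ℕ).prev n) = n + 1 := by simp
    change (KK P Y).d ((ComplexShape.down ℕ).prev n) n ≫ kk f = 0
    rw [this]
    exact kk_cocycle P hf
  refine Iff.trans (sc_kill ((KK P Y).sc n) (kk f) hk) ?_
  constructor
  · rintro ⟨l, hl⟩
    obtain ⟨g, rfl⟩ := kk_surj (X := P.complex.X ((ComplexShape.down ℕ).next n)) (Y := Y) l
    refine ⟨g, kk_inj ?_⟩
    rw [← map_kk]
    exact hl
  · rintro ⟨g, rfl⟩
    exact ⟨kk g, map_kk (P.complex.d n ((ComplexShape.down ℕ).next n)) g⟩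

lemma extMk_eq_zero_iff' (P : ProjectiveResolution X) {n : ℕ} (f : P.complex.X n ⟶ Y)
    (hf : P.complex.d (n+1) n ≫ f = 0) :
    P.extMk f (n+1) rfl hf = 0 ↔ ∃ g : P.complex.X ((ComplexShape.down ℕ).next n) ⟶ Y,
      P.complex.d n ((ComplexShape.down ℕ).next n) ≫ g = f := by
  rcases n with _ | n
  · have : ∀ j, P.complex.d 0 j = 0 := fun j => P.complex.shape _ _ (by simp)
    simp only [this, zero_comp, exists_const]
    constructor
    · intro h
      simp only [← P.extEquivCohomologyClass.apply_eq_iff_eq,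
        ProjectiveResolution.extEquivCohomologyClass_extMk,
        ProjectiveResolution.extEquivCohomologyClass_zero,
        CochainComplex.HomComplex.CohomologyClass.mk_eq_zero_iff] at h
      rw [CochainComplex.HomComplex.Cocycle.toSingleMk_mem_coboundaries_iff _ _ _ _ _ 1 (by simp)] at h
      obtain ⟨g, hg⟩ := h
      have : IsZero (P.cochainComplex.X 1) := by
        exact P.cochainComplex.isZero_of_isStrictlyLE 0 1 (by lia)
      rw [this.eq_of_src g 0, comp_zero] at hg
      rw [← cancel_epi (P.cochainComplexXIso (-((0:ℕ):ℤ)) 0 rfl).hom, ← hg, comp_zero]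
    · rintro rfl
      simp
  · have : ((ComplexShape.down ℕ).next (n+1)) = n := by simp
    rw [P.extMk_eq_zero_iff f _ rfl hf n rfl, this]

lemma oldHom_eq_zero_iff_extMk (P : ProjectiveResolution X) {n : ℕ} (f : P.complex.X n ⟶ Y)
    (hf : P.complex.d (n+1) n ≫ f = 0) :
    oldHom P f hf = 0 ↔ P.extMk f (n+1) rfl hf = 0 := by
  rw [oldHom_eq_zero_iff, extMk_eq_zero_iff']

lemma oldHom_natY (P : ProjectiveResolution X) {n : ℕ} (f : P.complex.X n ⟶ Y)
    (hf : P.complex.d (n+1) n ≫ f = 0) (g : Y ⟶ Y') :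
    (NatTrans.leftDerived (NatTrans.rightOp ((linearYoneda R (ModuleCat.{0} R)).map g)) n).app X ≫
      oldHom P f hf = oldHom P (f ≫ g) (by rw [reassoc_of% hf, zero_comp]) := by
  rw [P.leftDerived_app_eq]
  unfold oldHom
  simp only [Category.assoc, Iso.inv_hom_id_assoc]
  congr 1
  exact hι_desc_nat ((NatTrans.mapHomologicalComplex (NatTrans.rightOp
    ((linearYoneda R (ModuleCat R)).map g)) (ComplexShape.down ℕ)).app P.complex)
    (by simp) (kk f) (kk (f ≫ g)) (natTrans_kk f g) (kk_cocycle P hf) _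

lemma oldHom_natX (P : ProjectiveResolution X) (P' : ProjectiveResolution X') {n : ℕ}
    (f : P.complex.X n ⟶ Y)
    (hf : P.complex.d (n+1) n ≫ f = 0) (g : X' ⟶ X) (φ : ProjectiveResolution.Hom P' P g) :
    ((FF R Y).leftDerived n).map g ≫ oldHom P f hf =
      oldHom P' (φ.hom.f n ≫ f) (by simp [← φ.hom.comm_assoc, hf]) := by
  unfold oldHom
  refine (ProjectiveResolution.isoLeftDerivedObj_hom_naturality_assoc g P' P φ.hom
    (by simpa using φ.hom_f_zero_comp_π_f_zero) (FF R Y) n _).trans ?_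
  congr 1
  exact hι_desc_nat (((FF R Y).mapHomologicalComplex (ComplexShape.down ℕ)).map φ.hom)
    (by simp) (kk f) (kk (φ.hom.f n ≫ f)) (map_kk (φ.hom.f n) f) (kk_cocycle P hf) _
end

section
variable {X X' Y Y' : ModuleCat.{0} R}

noncomputable abbrev OExt (X Y : ModuleCat.{0} R) (n : ℕ) : ModuleCat R :=
  ((Ext R (ModuleCat R) n).obj (Opposite.op X)).obj Y

noncomputable def oldEl {n : ℕ} (h : ((FF R Y).leftDerived n).obj X ⟶ RR R) : OExt X Y n :=
  h.unop.hom (1 : R)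

lemma oldEl_add {n : ℕ} (h k : ((FF R Y).leftDerived n).obj X ⟶ RR R) :
    oldEl (h + k) = oldEl h + oldEl k := rfl

lemma oldEl_surj {n : ℕ} (e : OExt X Y n) :
    ∃ h : ((FF R Y).leftDerived n).obj X ⟶ RR R, oldEl h = e :=
  ⟨(ModuleCat.ofHom (LinearMap.toSpanSingleton R (OExt X Y n) e)).op, one_smul R e⟩

lemma oldEl_inj {n : ℕ} {h k : ((FF R Y).leftDerived n).obj X ⟶ RR R} (e : oldEl h = oldEl k) :
    h = k := by
  apply Quiver.Hom.unop_inj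
  ext
  exact e

lemma oldEl_natY {n : ℕ} (h : ((FF R Y).leftDerived n).obj X ⟶ RR R) (g : Y ⟶ Y') :
    (((Ext R (ModuleCat R) n).obj (Opposite.op X)).map g).hom (oldEl h) = oldEl
    ((NatTrans.leftDerived (NatTrans.rightOp ((linearYoneda R (ModuleCat.{0} R)).map g)) n).app X ≫
      h) := rfl

lemma oldEl_natX {n : ℕ} (h : ((FF R Y).leftDerived n).obj X ⟶ RR R) (g : X' ⟶ X) :
    (((Ext R (ModuleCat R) n).map g.op).app Y).hom (oldEl h) = oldEl
    (((FF R Y).leftDerived n).map g ≫ h) := rfl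

noncomputable def PHom (P : ProjectiveResolution X) (P' : ProjectiveResolution X') (g : X ⟶ X') :
    ProjectiveResolution.Hom P P' g where
  hom := ProjectiveResolution.lift g P P'
  hom_f_zero_comp_π_f_zero := by
    have := congrArg (fun t => t.f 0) (ProjectiveResolution.lift_commutes g P P')
    simpa only [HomologicalComplex.comp_f] using this

noncomputable def bridgeFun (X Y : ModuleCat.{0} R) (n : ℕ) (e : Abelian.Ext X Y n) : OExt X Y n :=
  oldEl (oldHom (projectiveResolution X)
    ((projectiveResolution X).extMk_surjective e (n+1) rfl).choose
    ((projectiveResolution X).extMk_surjective e (n+1) rfl).choose_spec.choose)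

lemma oldHom_congr (P : ProjectiveResolution X) {n : ℕ} (f g : P.complex.X n ⟶ Y)
    (hf : P.complex.d (n+1) n ≫ f = 0) (hg : P.complex.d (n+1) n ≫ g = 0)
    (h : P.extMk f (n+1) rfl hf = P.extMk g (n+1) rfl hg) : oldHom P f hf = oldHom P g hg := by
  have h1 := P.sub_extMk f g (n+1) rfl hf hg
  rw [h, sub_self, eq_comm, ← oldHom_eq_zero_iff_extMk] at h1
  have h2 := oldHom_add P (f - g) g (by simp [hf, hg]) hg
  have h3 := h2.trans ((congrArg (fun t => t + oldHom P g hg) h1).trans (zero_add _))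
  rw [← h3]
  congr 1
  simp

lemma bridgeFun_extMk {n : ℕ} (f : (projectiveResolution X).complex.X n ⟶ Y)
    (hf : (projectiveResolution X).complex.d (n+1) n ≫ f = 0) :
    bridgeFun X Y n ((projectiveResolution X).extMk f (n+1) rfl hf) =
      oldEl (oldHom (projectiveResolution X) f hf) := by
  unfold bridgeFun
  congr 1
  apply oldHom_congr
  exact ((projectiveResolution X).extMk_surjective _ (n+1) rfl).choose_spec.choose_spec

noncomputable def bridge (X Y : ModuleCat.{0} R) (n : ℕ) : Abelian.Ext X Y n →+ OExt X Y n :=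
  AddMonoidHom.mk' (bridgeFun X Y n) (by
    intro a b
    obtain ⟨f, hf, rfl⟩ := (projectiveResolution X).extMk_surjective a (n+1) rfl
    obtain ⟨g, hg, rfl⟩ := (projectiveResolution X).extMk_surjective b (n+1) rfl
    rw [(projectiveResolution X).add_extMk, bridgeFun_extMk, bridgeFun_extMk, bridgeFun_extMk,
      ← oldEl_add, oldHom_add])

lemma bridge_extMk {n : ℕ} (f : (projectiveResolution X).complex.X n ⟶ Y)
    (hf : (projectiveResolution X).complex.d (n+1) n ≫ f = 0) :
    bridge X Y n ((projectiveResolution X).extMk f (n+1) rfl hf) =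
      oldEl (oldHom (projectiveResolution X) f hf) := bridgeFun_extMk f hf

lemma bridge_bij (X Y : ModuleCat.{0} R) (n : ℕ) : Function.Bijective (bridge X Y n) := by
  constructor
  · rw [injective_iff_map_eq_zero]
    intro a h
    obtain ⟨f, hf, rfl⟩ := (projectiveResolution X).extMk_surjective a (n+1) rfl
    rw [← oldHom_eq_zero_iff_extMk]
    rw [bridge_extMk] at h
    exact oldEl_inj h
  · intro e
    obtain ⟨h, rfl⟩ := oldEl_surj e
    obtain ⟨f, hf, rfl⟩ := oldHom_surj (projectiveResolution X) h
    exact ⟨_, bridge_extMk f hf⟩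

lemma bridge_natY {n : ℕ} (e : Abelian.Ext X Y n) (g : Y ⟶ Y') :
    (((Ext R (ModuleCat R) n).obj (Opposite.op X)).map g).hom (bridge X Y n e) =
      bridge X Y' n (e.comp (Abelian.Ext.mk₀ g) (add_zero n)) := by
  obtain ⟨f, hf, rfl⟩ := (projectiveResolution X).extMk_surjective e (n+1) rfl
  rw [bridge_extMk, oldEl_natY, oldHom_natY, ProjectiveResolution.extMk_comp_mk₀, bridge_extMk]

lemma bridge_natX {n : ℕ} (e : Abelian.Ext X Y n) (g : X' ⟶ X) :
    (((Ext R (ModuleCat R) n).map g.op).app Y).hom (bridge X Y n e) =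
      bridge X' Y n ((Abelian.Ext.mk₀ g).comp e (zero_add n)) := by
  obtain ⟨f, hf, rfl⟩ := (projectiveResolution X).extMk_surjective e (n+1) rfl
  rw [bridge_extMk, oldEl_natX, oldHom_natX _ (projectiveResolution X') f hf g (PHom _ _ g),
    ProjectiveResolution.mk₀_comp_extMk _ _ _ _ (PHom _ _ g), bridge_extMk]
end

section
open localCohomology
variable (I : Ideal R)

abbrev QQ (n : ℕ) : ModuleCat.{0} R := (ringModIdeals (idealPowersDiagram I)).obj (op n)

def tr {n n' : ℕ} (h : n ≤ n') : QQ I n' ⟶ QQ I n :=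
  (ringModIdeals (idealPowersDiagram I)).map (homOfLE h).op

noncomputable abbrev HH (j : ℕ) (N : ModuleCat.{0} R) : ModuleCat.{0} R :=
  (localCohomology I j).obj N

noncomputable def cc (j : ℕ) : Cocone (diagram (idealPowersDiagram I) j) :=
  colimit.cocone (diagram (idealPowersDiagram I) j)

noncomputable def ccN (j : ℕ) (N : ModuleCat.{0} R) :=
  ((evaluation _ _).obj N).mapCocone (cc I j)

noncomputable def ccN_isColimit (j : ℕ) (N : ModuleCat.{0} R) : IsColimit (ccN I j N) :=
  isColimitOfPreserves ((evaluation _ _).obj N) (colimit.isColimit (diagram (idealPowersDiagram I) j))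

noncomputable def ii (j : ℕ) (N : ModuleCat.{0} R) (n : ℕ) : OExt (QQ I n) N j ⟶ HH I j N :=
  (ccN I j N).ι.app (op (op n))

noncomputable def Psi (j : ℕ) (N : ModuleCat.{0} R) (n : ℕ) :
    Abelian.Ext (QQ I n) N j →+ HH I j N :=
  (ii I j N n).hom.toAddMonoidHom.comp (bridge _ _ _)

lemma Psi_apply (j : ℕ) (N : ModuleCat.{0} R) (n : ℕ) (e : Abelian.Ext (QQ I n) N j) :
    Psi I j N n e = (ii I j N n).hom (bridge _ _ _ e) := rfl

lemma Psi_surj (j : ℕ) (N : ModuleCat.{0} R) (x : HH I j N) : ∃ n e, Psi I j N n e = x := by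
  obtain ⟨k, y, hy⟩ := Concrete.isColimit_exists_rep _ (ccN_isColimit I j N) x
  obtain ⟨n⟩ := k
  obtain ⟨n⟩ := n
  obtain ⟨e, rfl⟩ := (bridge_bij (QQ I n) N j).2 y
  exact ⟨n, e, hy⟩

lemma Psi_natY (j : ℕ) {N N' : ModuleCat.{0} R} (g : N ⟶ N') (n : ℕ)
    (e : Abelian.Ext (QQ I n) N j) :
    ((localCohomology I j).map g).hom (Psi I j N n e) =
      Psi I j N' n (e.comp (Abelian.Ext.mk₀ g) (add_zero j)) := by
  rw [Psi_apply, Psi_apply, ← bridge_natY]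
  have := ((cc I j).ι.app (op (op n))).naturality g
  exact (ConcreteCategory.congr_hom this (bridge _ _ _ e)).symm

lemma Psi_tr (j : ℕ) (N : ModuleCat.{0} R) {n n' : ℕ} (h : n ≤ n')
    (e : Abelian.Ext (QQ I n) N j) :
    Psi I j N n' ((Abelian.Ext.mk₀ (tr I h)).comp e (zero_add j)) = Psi I j N n e := by
  rw [Psi_apply, Psi_apply, ← bridge_natX]
  have := (ccN I j N).w (homOfLE h).op.op
  exact (ConcreteCategory.congr_hom this (bridge _ _ _ e))

lemma Psi_zero (j : ℕ) (N : ModuleCat.{0} R) {n : ℕ} (e : Abelian.Ext (QQ I n) N j)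
    (he : Psi I j N n e = 0) :
    ∃ n', ∃ h : n ≤ n', (Abelian.Ext.mk₀ (tr I h)).comp e (zero_add j) = 0 := by
  obtain ⟨k, f, g, h⟩ := Concrete.isColimit_exists_of_rep_eq _ (ccN_isColimit I j N)
    (i := op (op n)) (j := op (op n)) (bridge _ _ _ e) 0 (by
      rw [map_zero]
      exact he)
  obtain ⟨k⟩ := k
  obtain ⟨k⟩ := k
  have hle : n ≤ k := leOfHom f.unop.unop
  refine ⟨k, hle, (bridge_bij _ _ _).1 ?_⟩
  rw [← bridge_natX, map_zero]
  rw [map_zero] at h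
  exact h
end

section
open localCohomology
variable (I : Ideal R)

noncomputable abbrev Hm (j : ℕ) {N N' : ModuleCat.{0} R} (g : N ⟶ N') : HH I j N →ₗ[R] HH I j N' :=
  ((localCohomology I j).map g).hom

lemma Psi_eq (j : ℕ) (N : ModuleCat.{0} R) {n m : ℕ} (e : Abelian.Ext (QQ I n) N j)
    (e' : Abelian.Ext (QQ I m) N j) (he : Psi I j N n e = Psi I j N m e') :
    ∃ k, ∃ h : n ≤ k, ∃ h' : m ≤ k, (Abelian.Ext.mk₀ (tr I h)).comp e (zero_add j) =
      (Abelian.Ext.mk₀ (tr I h')).comp e' (zero_add j) := by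
  obtain ⟨k, f, g, h⟩ := Concrete.isColimit_exists_of_rep_eq _ (ccN_isColimit I j N)
    (i := op (op n)) (j := op (op m)) (bridge _ _ _ e) (bridge _ _ _ e') he
  obtain ⟨k⟩ := k
  obtain ⟨k⟩ := k
  refine ⟨k, leOfHom f.unop.unop, leOfHom g.unop.unop, (bridge_bij _ _ _).1 ?_⟩
  rw [← bridge_natX, ← bridge_natX]
  exact h

variable {I}

lemma H_exact {S : ShortComplex (ModuleCat.{0} R)} (hS : S.ShortExact) (j : ℕ) (x : HH I j S.X₂)
    (hx : Hm I j S.g x = 0) : ∃ y, Hm I j S.f y = x := by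
  obtain ⟨n, e, rfl⟩ := Psi_surj I j _ x
  rw [Psi_natY] at hx
  obtain ⟨n', h, h0⟩ := Psi_zero _ _ _ _ hx
  rw [← Abelian.Ext.comp_assoc_of_third_deg_zero] at h0
  obtain ⟨a, ha⟩ := Abelian.Ext.covariant_sequence_exact₂ _ hS _ h0
  refine ⟨Psi I j _ n' a, ?_⟩
  rw [Psi_natY, ha, Psi_tr]

lemma H_surj_of_inj {S : ShortComplex (ModuleCat.{0} R)} (hS : S.ShortExact) (j : ℕ)
    (hi : Function.Injective (Hm I (j+1) S.f)) : Function.Surjective (Hm I j S.g) := by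
  intro x
  obtain ⟨n, e, rfl⟩ := Psi_surj I j _ x
  have h0 : Psi I (j+1) S.X₁ n (e.comp hS.extClass rfl) = 0 := by
    apply hi
    rw [Psi_natY, map_zero, Abelian.Ext.comp_assoc_of_third_deg_zero, hS.extClass_comp,
      Abelian.Ext.comp_zero, map_zero]
  obtain ⟨n', h, h0⟩ := Psi_zero _ _ _ _ h0
  rw [← Abelian.Ext.comp_assoc (a₁₂ := j) _ _ _ (by simp) (by simp) (by simp)] at h0
  obtain ⟨a, ha⟩ := Abelian.Ext.covariant_sequence_exact₃ _ hS _ _ h0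
  refine ⟨Psi I j _ n' a, ?_⟩
  rw [Psi_natY, ha, Psi_tr]

lemma H_inj_of_surj {S : ShortComplex (ModuleCat.{0} R)} (hS : S.ShortExact) (j : ℕ)
    (hi : Function.Surjective (Hm I j S.g)) : Function.Injective (Hm I (j+1) S.f) := by
  rw [injective_iff_map_eq_zero]
  intro x hx
  obtain ⟨n, e, rfl⟩ := Psi_surj I _ _ x
  rw [Psi_natY] at hx
  obtain ⟨n', h, h0⟩ := Psi_zero _ _ _ _ hx
  rw [← Abelian.Ext.comp_assoc_of_third_deg_zero] at h0
  obtain ⟨a, ha⟩ := Abelian.Ext.covariant_sequence_exact₁ _ hS _ h0 rfl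
  obtain ⟨y, hy⟩ := hi (Psi I j _ n' a)
  obtain ⟨m, b, rfl⟩ := Psi_surj I _ _ y
  rw [Psi_natY] at hy
  obtain ⟨k, h1, h2, hk⟩ := Psi_eq _ _ _ _ _ hy
  rw [← Psi_tr I _ _ h, ← ha, ← Psi_tr I _ _ h2,
    ← Abelian.Ext.comp_assoc (a₁₂ := j) _ _ _ (by simp) (by simp) (by simp), ← hk,
    ← Abelian.Ext.comp_assoc_of_third_deg_zero,
    Abelian.Ext.comp_assoc_of_second_deg_zero, hS.comp_extClass, Abelian.Ext.comp_zero, map_zero]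

lemma H0_inj {N N' : ModuleCat.{0} R} (f : N ⟶ N') [Mono f] : Function.Injective (Hm I 0 f) := by
  rw [injective_iff_map_eq_zero]
  intro x hx
  obtain ⟨n, e, rfl⟩ := Psi_surj I _ _ x
  rw [Psi_natY] at hx
  obtain ⟨n', h, h0⟩ := Psi_zero _ _ _ _ hx
  rw [← Abelian.Ext.comp_assoc_of_third_deg_zero] at h0
  have := Abelian.Ext.postcomp_mk₀_injective_of_mono (QQ I n') f
    (a₁ := (Abelian.Ext.mk₀ (tr I h)).comp e (zero_add 0)) (a₂ := 0) (by
      rw [map_zero]; exact h0)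
  rw [← Psi_tr I _ _ h, this, map_zero]

lemma smul_id_QQ {n : ℕ} {a : R} (ha : a ∈ I ^ n) : a • 𝟙 (QQ I n) = 0 := by
  ext (x : R ⧸ I ^ n)
  obtain ⟨x, rfl⟩ := Ideal.Quotient.mk_surjective x
  change a • Ideal.Quotient.mk (I^n) x = 0
  rw [Algebra.smul_def, Ideal.Quotient.algebraMap_eq, Ideal.Quotient.eq_zero_iff_mem.2 ha, zero_mul]

lemma Hm_smul_id (j : ℕ) (N : ModuleCat.{0} R) (n : ℕ) (a : R) (e : Abelian.Ext (QQ I n) N j) :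
    Hm I j (a • 𝟙 N) (Psi I j N n e) = Psi I j N n (a • e) := by
  rw [Psi_natY, ← Abelian.Ext.smul_eq_comp_mk₀]

lemma ext_smul_zero {j : ℕ} {N : ModuleCat.{0} R} {n : ℕ} {a : R} (ha : a ∈ I ^ n)
    (e : Abelian.Ext (QQ I n) N j) : a • e = 0 := by
  have : a • e = (Abelian.Ext.mk₀ (a • 𝟙 (QQ I n))).comp e (zero_add j) := by
    rw [Abelian.Ext.mk₀_smul, Abelian.Ext.smul_comp, Abelian.Ext.mk₀_id_comp]
  rw [this, smul_id_QQ ha, Abelian.Ext.mk₀_zero, Abelian.Ext.zero_comp]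

lemma H_T {j : ℕ} {N : ModuleCat.{0} R} {x : R} (hx : x ∈ I)
    (hi : Function.Injective (Hm I j (x • 𝟙 N))) : Subsingleton (HH I j N) := by
  refine subsingleton_of_forall_eq 0 fun y => ?_
  obtain ⟨n, e, rfl⟩ := Psi_surj I _ _ y
  have key : ∀ k, Psi I j N n (x ^ k • e) = 0 → Psi I j N n e = 0 := by
    intro k
    induction k with
    | zero => simp
    | succ k ih =>
      intro h
      apply ih
      apply hi
      rw [Hm_smul_id, smul_smul, ← pow_succ', h, map_zero]
  apply key n
  rw [ext_smul_zero (Ideal.pow_mem_pow hx n), map_zero]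

lemma H_inj_zero {j : ℕ} {N : ModuleCat.{0} R} [Injective N] : Subsingleton (HH I (j+1) N) := by
  refine subsingleton_of_forall_eq 0 fun y => ?_
  obtain ⟨n, e, rfl⟩ := Psi_surj I _ _ y
  rw [Abelian.Ext.eq_zero_of_injective e, map_zero]
end

section
variable (I : Ideal R)

def IsTors (N : Type) [AddCommGroup N] [Module R N] : Prop :=
  ∀ x : N, ∃ k, ∀ a ∈ I ^ k, a • x = 0

def Gam (N : Type) [AddCommGroup N] [Module R N] : Submodule R N where
  carrier := {x | ∃ k, ∀ a ∈ I ^ k, a • x = 0}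
  zero_mem' := ⟨0, by simp⟩
  add_mem' := by
    rintro x y ⟨k, hk⟩ ⟨l, hl⟩
    refine ⟨max k l, fun a ha => ?_⟩
    rw [smul_add, hk a (Ideal.pow_le_pow_right (le_max_left _ _) ha),
      hl a (Ideal.pow_le_pow_right (le_max_right _ _) ha), add_zero]
  smul_mem' := by
    rintro r x ⟨k, hk⟩
    refine ⟨k, fun a ha => ?_⟩
    rw [smul_comm, hk a ha, smul_zero]

variable {I}

lemma isTors_Gam (N : Type) [AddCommGroup N] [Module R N] : IsTors I (Gam I N) := by
  rintro ⟨x, k, hk⟩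
  exact ⟨k, fun a ha => Subtype.ext (hk a ha)⟩

lemma IsTors.bound {N N' : Type} [AddCommGroup N] [Module R N] [AddCommGroup N'] [Module R N']
    [Module.Finite R N'] (h : IsTors I N) (g : N' →ₗ[R] N) :
    ∃ t, ∀ a ∈ I ^ t, ∀ y, a • g y = 0 := by
  obtain ⟨s, hs⟩ := (Module.Finite.fg_top : (⊤ : Submodule R N').FG)
  choose k hk using h
  refine ⟨s.sup (fun y => k (g y)), fun a ha y => ?_⟩
  have hy : y ∈ Submodule.span R (s : Set N') := by rw [hs]; trivial
  induction hy using Submodule.span_induction with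
  | mem x hx =>
    exact hk _ a (Ideal.pow_le_pow_right (Finset.le_sup (f := fun y => k (g y)) hx) ha)
  | zero => simp
  | add x y _ _ hx hy => rw [map_add, smul_add, hx, hy, add_zero]
  | smul r x _ hx => rw [map_smul, smul_comm, hx, smul_zero]

lemma Gam_baer [IsNoetherianRing R] (N : Type) [AddCommGroup N] [Module R N] [Module.Injective R N] :
    Module.Baer R (Gam I N) := by
  intro J g
  obtain ⟨t, ht⟩ := (isTors_Gam (I := I) N).bound g
  obtain ⟨c, hc⟩ := I.exists_pow_inf_eq_pow_smul (M := R) J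
  have h0 : ∀ z (hz : z ∈ J), z ∈ I ^ (t + c) → g ⟨z, hz⟩ = 0 := by
    intro z hz hz'
    have h1 : z ∈ (I ^ (t+c) • ⊤ : Submodule R R) ⊓ J := ⟨by simpa using hz', hz⟩
    rw [hc (t+c) (by lia), Nat.add_sub_cancel] at h1
    have h2 : z ∈ I ^ t • J := smul_mono_right (I ^ t) (inf_le_right (a := (I ^ c • ⊤ : Submodule R R)) (b := J)) h1
    have h3 : ∀ z ∈ I ^ t • J, ∃ hz : z ∈ J, g ⟨z, hz⟩ = 0 := by
      intro z hz
      induction hz using Submodule.smul_induction_on' with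
      | smul r hr n hn =>
        refine ⟨J.smul_mem r hn, ?_⟩
        have := ht r hr ⟨n, hn⟩
        rw [← map_smul] at this
        exact this
      | add x hx y hy hx' hy' =>
        obtain ⟨a, ha⟩ := hx'
        obtain ⟨b, hb⟩ := hy'
        refine ⟨J.add_mem a b, ?_⟩
        have := map_add g ⟨x, a⟩ ⟨y, b⟩
        rw [ha, hb, add_zero] at this
        exact this
    exact (h3 z h2).2
  let K : Submodule R J := Submodule.comap J.subtype (I ^ (t+c) : Ideal R)
  let f : (J ⧸ K) →ₗ[R] (R ⧸ I ^ (t+c)) := Submodule.mapQ K (I^(t+c)) J.subtype le_rfl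
  have hf : Function.Injective f := by
    rw [injective_iff_map_eq_zero]
    intro y hy
    obtain ⟨y, rfl⟩ := Submodule.Quotient.mk_surjective _ y
    have h1 : (Submodule.Quotient.mk (y : R) : R ⧸ I ^ (t+c)) = 0 := hy
    rw [Submodule.Quotient.mk_eq_zero] at h1 ⊢
    exact h1
  let g1 : (J ⧸ K) →ₗ[R] N := K.liftQ ((Gam I N).subtype ∘ₗ g) (by
    rintro ⟨z, hz⟩ hz'
    rw [LinearMap.mem_ker, LinearMap.comp_apply, h0 z hz hz', map_zero])
  obtain ⟨h, hh⟩ := Module.Injective.out f hf g1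
  refine ⟨LinearMap.codRestrict (Gam I N) (h ∘ₗ Submodule.mkQ (I^(t+c))) ?_, ?_⟩
  · intro r
    refine ⟨t+c, fun a ha => ?_⟩
    rw [← map_smul]
    have : a • r ∈ I^(t+c) := Ideal.mul_mem_right _ _ ha
    rw [LinearMap.comp_apply, Submodule.mkQ_apply, (Submodule.Quotient.mk_eq_zero _).2 this, map_zero]
  · intro x hx
    apply Subtype.ext
    exact hh (K.mkQ ⟨x, hx⟩)

instance [IsNoetherianRing R] (N : ModuleCat.{0} R) [Injective N] :
    Injective (ModuleCat.of R (Gam I N)) := by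
  have : Module.Injective R N := Module.injective_module_of_injective_object R N
  have : Module.Injective R (Gam I N) := (Gam_baer (I := I) N).injective
  exact Module.injective_object_of_injective_module R (Gam I N)

lemma ses_mk {A B C : Type} [AddCommGroup A] [AddCommGroup B] [AddCommGroup C] [Module R A]
    [Module R B] [Module R C] (f : A →ₗ[R] B) (g : B →ₗ[R] C) (hf : Function.Injective f)
    (hg : Function.Surjective g) (h : Function.Exact f g) :
    (ShortComplex.mk (ModuleCat.ofHom f) (ModuleCat.ofHom g) (by
      ext x; exact h.apply_apply_eq_zero x)).ShortExact where
  exact := by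
    rw [ShortComplex.moduleCat_exact_iff]
    intro x hx
    exact (h x).1 hx
  mono_f := (ModuleCat.mono_iff_injective _).2 hf
  epi_g := (ModuleCat.epi_iff_surjective _).2 hg

def one' (I : Ideal R) (n : ℕ) : QQ I n := (Submodule.Quotient.mk 1 : R ⧸ I ^ n)

lemma tr_one {n n' : ℕ} (h : n ≤ n') : (tr I h).hom (one' I n') = one' I n := rfl

lemma QQ_ext {n : ℕ} {N : ModuleCat.{0} R} {f g : QQ I n ⟶ N}
    (h : f.hom (one' I n) = g.hom (one' I n)) : f = g := by
  ext (x : R ⧸ I ^ n)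
  obtain ⟨x, rfl⟩ := Ideal.Quotient.mk_surjective x
  have : (Ideal.Quotient.mk (I^n) x : QQ I n) = x • one' I n := by
    change (Ideal.Quotient.mk (I^n) x) = x • (Ideal.Quotient.mk (I^n) 1)
    rw [Algebra.smul_def, Ideal.Quotient.algebraMap_eq, map_one, mul_one]
  have h2 : f.hom (x • one' I n) = g.hom (x • one' I n) := by rw [map_smul, map_smul, h]
  rw [← this] at h2
  exact h2

def QQ_desc {n : ℕ} {N : ModuleCat.{0} R} (y : N) (h : ∀ a ∈ I ^ n, a • y = 0) : QQ I n ⟶ N :=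
  ModuleCat.ofHom (X := R ⧸ I ^ n) (Submodule.liftQ (I ^ n) (LinearMap.toSpanSingleton R N y)
    (fun a ha => h a ha))

lemma QQ_desc_one {n : ℕ} {N : ModuleCat.{0} R} (y : N) (h : ∀ a ∈ I ^ n, a • y = 0) :
    (QQ_desc y h).hom (one' I n) = y := one_smul R y

lemma H0_surj {N N' : ModuleCat.{0} R} (g : N ⟶ N') (hg : Function.Surjective g.hom)
    (hN : IsTors I N) : Function.Surjective (Hm I 0 g) := by
  intro x
  obtain ⟨n, e, rfl⟩ := Psi_surj I _ _ x
  obtain ⟨φ, rfl⟩ := (Abelian.Ext.mk₀_bijective _ _).2 e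
  obtain ⟨y, hy⟩ := hg (φ.hom (one' I n))
  obtain ⟨k, hk⟩ := hN y
  have hk' : ∀ a ∈ I ^ (max n k), a • y = 0 := fun a ha =>
    hk a (Ideal.pow_le_pow_right (le_max_right _ _) ha)
  refine ⟨Psi I 0 N (max n k) (Abelian.Ext.mk₀ (QQ_desc y hk')), ?_⟩
  rw [Psi_natY, ← Psi_tr I _ _ (le_max_left n k), Abelian.Ext.mk₀_comp_mk₀,
    Abelian.Ext.mk₀_comp_mk₀]
  congr 2
  apply QQ_ext
  rw [ModuleCat.hom_comp, LinearMap.comp_apply, QQ_desc_one, hy, ModuleCat.hom_comp,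
    LinearMap.comp_apply, tr_one]

lemma H0_nontrivial {N : ModuleCat.{0} R} (hN : IsTors I N) [Nontrivial N] :
    Nontrivial (HH I 0 N) := by
  obtain ⟨y, hy⟩ := exists_ne (0 : N)
  obtain ⟨k, hk⟩ := hN y
  refine ⟨Psi I 0 N k (Abelian.Ext.mk₀ (QQ_desc y hk)), 0, fun h0 => hy ?_⟩
  obtain ⟨n', h, h0⟩ := Psi_zero _ _ _ _ h0
  rw [Abelian.Ext.mk₀_comp_mk₀, Abelian.Ext.mk₀_eq_zero_iff] at h0
  have : (tr I h ≫ QQ_desc y hk).hom (one' I n') = 0 := by rw [h0]; rfl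
  rwa [ModuleCat.hom_comp, LinearMap.comp_apply, tr_one, QQ_desc_one] at this

lemma tors_vanish [IsNoetherianRing R] (j : ℕ) (N : Type) [AddCommGroup N] [Module R N]
    (hN : IsTors I N) : Subsingleton (HH I (j+1) (ModuleCat.of R N)) := by
  have key : ∃ (E : Type) (_ : AddCommGroup E) (_ : Module R E) (i : N →ₗ[R] E),
      Injective (ModuleCat.of R E) ∧ IsTors I E ∧ Function.Injective i := by
    let E := Injective.under (ModuleCat.of R N)
    have hi := (ModuleCat.mono_iff_injective (Injective.ι (ModuleCat.of R N))).1 inferInstance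
    refine ⟨Gam I E, inferInstance, inferInstance,
      LinearMap.codRestrict (Gam I E) (Injective.ι (ModuleCat.of R N)).hom ?_, inferInstance,
      isTors_Gam E, ?_⟩
    · intro c
      obtain ⟨k, hk⟩ := hN c
      refine ⟨k, fun a ha => ?_⟩
      rw [← map_smul]
      erw [hk a ha]
      rw [map_zero]
    · intro a b hab
      exact hi (congrArg Subtype.val hab)
  obtain ⟨E, _, _, i, hE, hET, hi⟩ := key
  have hS := ses_mk i (LinearMap.range i).mkQ hi (Submodule.mkQ_surjective _) (by
    rw [LinearMap.exact_iff, Submodule.ker_mkQ])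
  have hC : IsTors I (E ⧸ LinearMap.range i) := by
    intro x
    obtain ⟨y, rfl⟩ := Submodule.mkQ_surjective _ x
    obtain ⟨k, hk⟩ := hET y
    exact ⟨k, fun a ha => by rw [← map_smul, hk a ha, map_zero]⟩
  have hE0 : Subsingleton (HH I (j+1) (ModuleCat.of R E)) := H_inj_zero
  refine Function.Injective.subsingleton (H_inj_of_surj hS j ?_)
  cases j with
  | zero => exact H0_surj _ (Submodule.mkQ_surjective _) hET
  | succ j =>
    have := tors_vanish j _ hC
    intro x
    exact ⟨0, this.elim _ _⟩
end

section
open IsLocalRing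

lemma IsTors_of_dim_zero [IsNoetherianRing R] [IsLocalRing R] (N : Type) [AddCommGroup N]
    [Module R N] [Module.Finite R N] (h : Module.supportDim R N = 0) :
    IsTors (maximalIdeal R) N := by
  have h1 := support_of_supportDim_eq_zero R N h
  rw [Module.support_eq_zeroLocus, PrimeSpectrum.zeroLocus_eq_iff] at h1
  obtain ⟨k, hk⟩ := Ideal.exists_pow_le_of_le_radical_of_fg
    (Ideal.le_radical.trans h1.ge) (IsNoetherian.noetherian _)
  exact fun x => ⟨k, fun a ha => Module.mem_annihilator.1 (hk ha) x⟩

theorem cm_main [IsNoetherianRing R] [IsLocalRing R] (d : ℕ) (N : Type) [AddCommGroup N]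
    [Module R N] [Module.Finite R N] (hd : Module.supportDim R N = d)
    (hE : ∀ i < d, Subsingleton (Abelian.Ext (ModuleCat.of R (R ⧸ maximalIdeal R))
      (ModuleCat.of R N) i)) :
    (∀ j ≠ d, Subsingleton (HH (maximalIdeal R) j (ModuleCat.of R N))) ∧
      Nontrivial (HH (maximalIdeal R) d (ModuleCat.of R N)) := by
  induction d generalizing N with
  | zero =>
    have hT := IsTors_of_dim_zero N hd
    have : Nontrivial N := (Module.supportDim_ne_bot_iff_nontrivial R N).1 (by rw [hd]; simp)
    have : Nontrivial (ModuleCat.of R N) := this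
    refine ⟨?_, H0_nontrivial (N := ModuleCat.of R N) hT⟩
    rintro (_ | j) hj
    · exact absurd rfl hj
    · exact tors_vanish j N hT
  | succ d ih =>
    have : Subsingleton (ModuleCat.of R (R ⧸ maximalIdeal R) ⟶ ModuleCat.of R N) :=
      Abelian.Ext.addEquiv₀.subsingleton_congr.mp (hE 0 d.zero_lt_succ)
    have : Subsingleton ((R ⧸ maximalIdeal R) →ₗ[R] N) :=
      ⟨fun a b => congrArg ModuleCat.Hom.hom
        (Subsingleton.elim (ModuleCat.ofHom a) (ModuleCat.ofHom b))⟩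
    obtain ⟨x, mem_ann, reg⟩ := IsSMulRegular.subsingleton_linearMap_iff.mp this
    have hx : x ∈ maximalIdeal R := by rwa [Ideal.annihilator_quotient] at mem_ann
    have hS := IsSMulRegular.smulShortComplex_shortExact (M := ModuleCat.of R N) reg
    have hd' : Module.supportDim R (QuotSMulTop x N) = d := by
      have := Module.supportDim_quotSMulTop_succ_eq_supportDim reg hx
      rw [hd] at this
      generalize Module.supportDim R (QuotSMulTop x N) = t at this
      cases t with
      | bot => exact absurd this (by simp; exact fun h => by cases h)
      | coe t =>
        cases t with
        | top => exact absurd this (by simp; exact fun h => by cases h)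
        | coe t => 
          norm_cast at this ⊢
          omega
    have h_ext' : ∀ i < d, Subsingleton (Abelian.Ext (ModuleCat.of R (R ⧸ maximalIdeal R))
        (ModuleCat.of R (QuotSMulTop x N)) i) := by
      intro i hi
      have zero1 := AddCommGrpCat.isZero_of_iff_subsingleton.mpr (hE i (by omega))
      have zero2 := AddCommGrpCat.isZero_of_iff_subsingleton.mpr (hE (i + 1) (by omega))
      exact AddCommGrpCat.subsingleton_of_isZero <| ShortComplex.Exact.isZero_of_both_zeros
        ((Abelian.Ext.covariant_sequence_exact₃' _ hS) i (i + 1) rfl)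
        (zero1.eq_zero_of_src _) (zero2.eq_zero_of_tgt _)
    obtain ⟨h1, h2⟩ := ih (QuotSMulTop x N) hd' h_ext'
    have key : ∀ j ≠ d+1, Subsingleton (HH (maximalIdeal R) j (ModuleCat.of R N)) := by
      intro j hj
      apply H_T hx
      rw [← ModuleCat.smulShortComplex_f_eq_smul_id]
      rcases j with _ | j
      · exact @H0_inj _ _ _ _ _ _ hS.mono_f
      · apply H_inj_of_surj hS j
        have := h1 j (by omega)
        intro y
        exact ⟨0, this.elim _ _⟩
    refine ⟨key, ?_⟩
    by_contra hn
    rw [not_nontrivial_iff_subsingleton] at hn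
    have hsurj : Function.Surjective (Hm (maximalIdeal R) d (ModuleCat.smulShortComplex (ModuleCat.of R N) x).g) :=
      H_surj_of_inj hS d (fun a b _ => hn.elim a b)
    have := key d (by omega)
    have h3 : Subsingleton (HH (maximalIdeal R) d (ModuleCat.of R (QuotSMulTop x N))) :=
      @Function.Surjective.subsingleton _ _ _ this hsurj
    exact not_subsingleton _ h3
end

section
open IsLocalRing

lemma cm_dim [IsNoetherianRing R] [IsLocalRing R] (N : Type) [AddCommGroup N]
    [Module R N] [Module.Finite R N] (h : IsCM R (maximalIdeal R) N) :
    ∃ d : ℕ, mDim R N = (d : WithBot ℕ∞) := by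
  have h1 : Module.supportDim R N ≠ ⊥ := by
    rw [Module.supportDim_ne_bot_iff_nontrivial]; exact h.1
  have h2 : Module.supportDim R N < ⊤ :=
    (Module.supportDim_le_ringKrullDim R N).trans_lt ringKrullDim_lt_top
  change ∃ d : ℕ, Module.supportDim R N = (d : WithBot ℕ∞)
  generalize Module.supportDim R N = t at h1 h2
  cases t with
  | bot => exact absurd rfl h1
  | coe t =>
    cases t with
    | top => exact absurd h2 (lt_irrefl _)
    | coe t => exact ⟨t, rfl⟩

lemma cm_H [IsNoetherianRing R] [IsLocalRing R] (N : Type) [AddCommGroup N]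
    [Module R N] [Module.Finite R N] (h : IsCM R (maximalIdeal R) N) (d : ℕ)
    (hd : mDim R N = (d : WithBot ℕ∞)) :
    (∀ j ≠ d, Subsingleton (HH (maximalIdeal R) j (ModuleCat.of R N))) ∧
      Nontrivial (HH (maximalIdeal R) d (ModuleCat.of R N)) := by
  apply cm_main d N hd
  intro i hi
  have hdep : mDepth R (maximalIdeal R) N = (d : ℕ∞) := by
    have := h.2.trans hd
    exact WithBot.coe_injective this
  have hs : Subsingleton (extC R i (R ⧸ maximalIdeal R) N) := by
    rw [← not_nontrivial_iff_subsingleton]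
    intro hn
    have hle : mDepth R (maximalIdeal R) N ≤ (i : ℕ∞) := sInf_le ⟨i, rfl, hn⟩
    rw [hdep] at hle
    exact absurd (Nat.cast_le.1 hle) (by omega)
  exact ⟨fun a b => (bridge_bij _ _ _).1 (@Subsingleton.elim _ hs _ _)⟩

variable {M : Type} [AddCommGroup M] [Module R M]

lemma sq_ses (N N' : Submodule R M) (h : N ≤ N') :
    ∃ w, (ShortComplex.mk (ModuleCat.ofHom (Submodule.inclusion h))
      (ModuleCat.ofHom ((Submodule.comap N'.subtype N).mkQ)) w).ShortExact :=
  ⟨_, ses_mk (Submodule.inclusion h) ((Submodule.comap N'.subtype N).mkQ)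
    (Submodule.inclusion_injective h) (Submodule.mkQ_surjective _) (by
      rw [LinearMap.exact_iff, Submodule.ker_mkQ, Submodule.range_inclusion])⟩

variable {I : Ideal R}

lemma step_van (N N' : Submodule R M) (h : N ≤ N') (j : ℕ)
    (h1 : Subsingleton (HH I j (ModuleCat.of R N)))
    (h2 : Subsingleton (HH I j (ModuleCat.of R (subQuot R N N')))) :
    Subsingleton (HH I j (ModuleCat.of R N')) := by
  obtain ⟨w, hS⟩ := sq_ses N N' h
  have key : ∀ x : HH I j (ModuleCat.of R N'), x = 0 := by
    intro x
    obtain ⟨y, rfl⟩ := H_exact hS j x (h2.elim _ _)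
    rw [h1.elim y 0, map_zero]
  exact ⟨fun a b => (key a).trans (key b).symm⟩

lemma step_quot (N N' : Submodule R M) (h : N ≤ N') (j : ℕ)
    (h1 : Subsingleton (HH I j (ModuleCat.of R N)))
    (h2 : Subsingleton (HH I (j + 1) (ModuleCat.of R N))) :
    Nonempty (HH I j (ModuleCat.of R N') ≃ₗ[R] HH I j (ModuleCat.of R (subQuot R N N'))) := by
  obtain ⟨w, hS⟩ := sq_ses N N' h
  refine ⟨LinearEquiv.ofBijective (Hm I j _) ⟨?_, H_surj_of_inj hS j fun a b _ => h2.elim a b⟩⟩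
  rw [injective_iff_map_eq_zero]
  intro x hx
  obtain ⟨y, rfl⟩ := H_exact hS j x hx
  rw [h1.elim y 0, map_zero]

lemma step_sub (N N' : Submodule R M) (h : N ≤ N') (j : ℕ)
    (h1 : ∀ k ≤ j, Subsingleton (HH I k (ModuleCat.of R (subQuot R N N')))) :
    Nonempty (HH I j (ModuleCat.of R N') ≃ₗ[R] HH I j (ModuleCat.of R N)) := by
  obtain ⟨w, hS⟩ := sq_ses N N' h
  refine ⟨(LinearEquiv.ofBijective (Hm I j (ModuleCat.ofHom (Submodule.inclusion h)))
    ⟨?_, fun x => H_exact hS j x ((h1 j le_rfl).elim _ _)⟩).symm⟩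
  rcases j with _ | j
  · exact @H0_inj _ _ _ _ _ _ hS.mono_f
  · exact H_inj_of_surj hS j fun y => ⟨0, (h1 j (by omega)).elim _ _⟩

theorem main_aux [IsNoetherianRing R] [IsLocalRing R] [Module.Finite R M]
    (r : ℕ) (F : ℕ → Submodule R M) (hF : IsSCMFil R (maximalIdeal R) r F) :
    (∀ j : ℕ,
      (Nontrivial (HH (maximalIdeal R) j (ModuleCat.of R M)) ↔
        ∃ i < r, mDim R (subQuot R (F i) (F (i + 1))) = (j : WithBot ℕ∞))) ∧
    (∀ i < r, ∀ j : ℕ, mDim R (subQuot R (F i) (F (i + 1))) = (j : WithBot ℕ∞) →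
      Nonempty
        (HH (maximalIdeal R) j (ModuleCat.of R M) ≃ₗ[R]
          HH (maximalIdeal R) j (ModuleCat.of R (F (i + 1)))) ∧
      Nonempty
        (HH (maximalIdeal R) j (ModuleCat.of R (F (i + 1))) ≃ₗ[R]
          HH (maximalIdeal R) j (ModuleCat.of R (subQuot R (F i) (F (i + 1)))))) := by
  obtain ⟨h0, hr, hlt, hcm, hdim⟩ := hF
  have hex : ∀ i, ∃ d : ℕ, i < r → mDim R (subQuot R (F i) (F (i + 1))) = (d : WithBot ℕ∞) := by
    intro i
    by_cases hi : i < r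
    · obtain ⟨d, hd⟩ := cm_dim _ (hcm i hi)
      exact ⟨d, fun _ => hd⟩
    · exact ⟨0, fun h => absurd h hi⟩
  choose d hd using hex
  have hinc : ∀ i, i + 1 < r → d i < d (i + 1) := by
    intro i hi
    have := hdim i hi
    rw [hd i (by omega), show i + 2 = (i + 1) + 1 from rfl, hd (i + 1) hi] at this
    exact_mod_cast this
  have hmono : ∀ k i, i < k → k < r → d i < d k := by
    intro k
    induction k with
    | zero => intro i hi; omega
    | succ k ih =>
      intro i hi hk
      rcases Nat.lt_succ_iff_lt_or_eq.1 hi with h | rfl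
      · exact (ih i h (by omega)).trans (hinc k hk)
      · exact hinc i hk
  have hQ : ∀ i < r, ∀ j ≠ d i, Subsingleton (HH (maximalIdeal R) j
      (ModuleCat.of R (subQuot R (F i) (F (i + 1))))) := fun i hi =>
    (cm_H _ (hcm i hi) (d i) (hd i hi)).1
  have hQn : ∀ i < r, Nontrivial (HH (maximalIdeal R) (d i)
      (ModuleCat.of R (subQuot R (F i) (F (i + 1))))) := fun i hi =>
    (cm_H _ (hcm i hi) (d i) (hd i hi)).2
  have hvan : ∀ i ≤ r, ∀ j, (∀ k < i, j ≠ d k) →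
      Subsingleton (HH (maximalIdeal R) j (ModuleCat.of R (F i))) := by
    intro i
    induction i with
    | zero =>
      intro _ j _
      have hz : IsZero (ModuleCat.of R (F 0)) := by
        have : Subsingleton (F 0) := by rw [h0]; infer_instance
        exact ModuleCat.isZero_of_subsingleton _
      have hT : IsTors (maximalIdeal R) (F 0) := fun x => ⟨0, fun a _ => by
        have : Subsingleton (F 0) := by rw [h0]; infer_instance
        exact Subsingleton.elim _ _⟩
      rcases j with _ | j
      · have : Injective (ModuleCat.of R (F 0)) := hz.injective
        refine H_T (x := 0) (Ideal.zero_mem _) ?_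
        have : (0 : R) • 𝟙 (ModuleCat.of R (F 0)) = 𝟙 _ := hz.eq_of_src _ _
        rw [this]
        exact @H0_inj _ _ _ _ _ _ inferInstance
      · exact tors_vanish j _ hT
    | succ i ih =>
      intro hi j hj
      exact step_van (F i) (F (i + 1)) (hlt i (by omega)).le j
        (ih (by omega) j fun k hk => hj k (by omega)) (hQ i (by omega) j (hj i (by omega)))
  have hup : ∀ i < r, ∀ k, i + 1 + k ≤ r → Nonempty
      (HH (maximalIdeal R) (d i) (ModuleCat.of R (F (i + 1 + k))) ≃ₗ[R]
        HH (maximalIdeal R) (d i) (ModuleCat.of R (F (i + 1)))) := by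
    intro i hi k
    induction k with
    | zero => intro _; exact ⟨LinearEquiv.refl _ _⟩
    | succ k ih =>
      intro hk
      obtain ⟨e⟩ := ih (by omega)
      obtain ⟨e'⟩ := step_sub (I := maximalIdeal R) (F (i + 1 + k)) (F (i + 1 + k + 1))
        (hlt _ (by omega)).le (d i) (fun l hl => hQ _ (by omega) l (by
          have := hmono (i + 1 + k) i (by omega) (by omega)
          omega))
      exact ⟨e'.trans e⟩
  have htop : ∀ j, Nonempty (HH (maximalIdeal R) j (ModuleCat.of R M) ≃ₗ[R]
      HH (maximalIdeal R) j (ModuleCat.of R (F r))) := fun j =>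
    ⟨((localCohomology (maximalIdeal R) j).mapIso
      (LinearEquiv.ofTop (F r) hr).symm.toModuleIso).toLinearEquiv⟩
  have hM : ∀ i < r, Nonempty (HH (maximalIdeal R) (d i) (ModuleCat.of R M) ≃ₗ[R]
      HH (maximalIdeal R) (d i) (ModuleCat.of R (F (i + 1)))) := by
    intro i hi
    obtain ⟨k, hk⟩ := Nat.exists_eq_add_of_le (show i + 1 ≤ r from hi)
    obtain ⟨e⟩ := hup i hi k hk.ge
    obtain ⟨e'⟩ := htop (d i)
    rw [← hk] at e
    exact ⟨e'.trans e⟩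
  have hS : ∀ i < r, Nonempty (HH (maximalIdeal R) (d i) (ModuleCat.of R (F (i + 1))) ≃ₗ[R]
      HH (maximalIdeal R) (d i) (ModuleCat.of R (subQuot R (F i) (F (i + 1))))) := by
    intro i hi
    apply step_quot _ _ (hlt i hi).le
    · exact hvan i hi.le _ fun k hk => (hmono i k hk hi).ne'
    · exact hvan i hi.le _ fun k hk => by have := hmono i k hk hi; omega
  have hdj : ∀ i < r, ∀ j : ℕ, mDim R (subQuot R (F i) (F (i + 1))) = (j : WithBot ℕ∞) →
      d i = j := by
    intro i hi j hj
    have := (hd i hi).symm.trans hj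
    exact_mod_cast this
  refine ⟨fun j => ⟨fun hn => ?_, ?_⟩, ?_⟩
  · by_contra hc
    push Not at hc
    obtain ⟨e⟩ := htop j
    have hs := hvan r le_rfl j fun k hk he => hc k hk (by rw [he]; exact hd k hk)
    exact not_subsingleton_iff_nontrivial.2 hn e.toEquiv.subsingleton
  · rintro ⟨i, hi, hj⟩
    obtain rfl := hdj i hi j hj
    obtain ⟨e⟩ := hM i hi
    obtain ⟨e'⟩ := hS i hi
    have := hQn i hi
    exact (e.trans e').toEquiv.nontrivial
  · intro i hi j hj
    obtain rfl := hdj i hi j hj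
    exact ⟨hM i hi, hS i hi⟩
end

end
open IsLocalRing in
/-- If `M` is a sequentially Cohen-Macaulay module over a Noetherian local
ring `(R, 𝔪)` with sCM filtration `0 = M₀ ⊊ M₁ ⊊ ⋯ ⊊ M_r = M` and `d_i = dim (M_i/M_{i-1})`,
then `H^j_𝔪(M) ≠ 0` iff `j ∈ {d_1, …, d_r}`, and `H^{d_i}_𝔪(M) ≅ H^{d_i}_𝔪(M_i) ≅
H^{d_i}_𝔪(M_i/M_{i-1})`. -/
theorem stmt0 (R : Type) [CommRing R] [IsNoetherianRing R] [IsLocalRing R]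
    (M : Type) [AddCommGroup M] [Module R M] [Module.Finite R M]
    (r : ℕ) (F : ℕ → Submodule R M) (hF : IsSCMFil R (maximalIdeal R) r F) :
    (∀ j : ℕ,
      (Nontrivial ↥((localCohomology (maximalIdeal R) j).obj (ModuleCat.of R M)) ↔
        ∃ i < r, mDim R (subQuot R (F i) (F (i + 1))) = (j : WithBot ℕ∞))) ∧
    (∀ i < r, ∀ j : ℕ, mDim R (subQuot R (F i) (F (i + 1))) = (j : WithBot ℕ∞) →
      Nonempty
        (↥((localCohomology (maximalIdeal R) j).obj (ModuleCat.of R M)) ≃ₗ[R]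
          ↥((localCohomology (maximalIdeal R) j).obj (ModuleCat.of R ↥(F (i + 1))))) ∧
      Nonempty
        (↥((localCohomology (maximalIdeal R) j).obj (ModuleCat.of R ↥(F (i + 1)))) ≃ₗ[R]
          ↥((localCohomology (maximalIdeal R) j).obj
            (ModuleCat.of R (subQuot R (F i) (F (i + 1))))))) := by
  exact main_aux r F hF
end

section
/- Let I be a weakly stable monomial ideal of the polynomial ring S = k[x_1,…,x_n]. Then S/I is sequentially Cohen-Macaulay. -/
open CategoryTheory

open CategoryTheory Abelian Limits

lemma exShift {R : Type} [CommRing R] (K M N : ModuleCat.{0} R) (x : R)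
    (hx : x ∈ Module.annihilator R K) (hreg : IsSMulRegular M x) (g : M →ₗ[R] N)
    (hg : Function.Surjective g) (hk : ∀ m, g m = 0 ↔ ∃ m', m = x • m') (c : ℕ)
    (h : (∀ i < c, Subsingleton (Abelian.Ext K N i)) ∧ Nontrivial (Abelian.Ext K N c)) :
    (∀ i < c + 1, Subsingleton (Abelian.Ext K M i)) ∧ Nontrivial (Abelian.Ext K M (c+1)) := by
  let S : ShortComplex (ModuleCat.{0} R) := ShortComplex.mk (x • 𝟙 M) (ModuleCat.ofHom g) (by
    ext m
    exact (hk _).2 ⟨m, rfl⟩)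
  have hmono : Mono S.f := by
    rw [ModuleCat.mono_iff_injective]
    intro a b hab
    exact hreg hab
  have hS : S.ShortExact := by
    refine { exact := ?_, mono_f := hmono, epi_g := ?_ }
    · rw [ShortComplex.moduleCat_exact_iff]
      intro m hm
      obtain ⟨m', h⟩ := (hk m).1 hm
      exact ⟨m', h.symm⟩
    · rw [ModuleCat.epi_iff_surjective]
      exact hg
  have key : ∀ i, Mono (AddCommGrpCat.ofHom ((Ext.mk₀ S.f).postcomp K (add_zero i))) →
      Subsingleton (Abelian.Ext K M i) := by
    intro i hm
    have zero_gk : AddCommGrpCat.ofHom ((Ext.mk₀ S.f).postcomp K (add_zero i)) = 0 := Ext.postcomp_smul_id_eq_zero_of_mem_annihilator hx i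
    exact AddCommGrpCat.subsingleton_of_isZero (IsZero.of_mono_eq_zero _ zero_gk)
  have h1 : ∀ i < c + 1, Subsingleton (Abelian.Ext K M i) := by
    intro i hi
    apply key
    match i with
    | 0 => exact Ext.mono_postcomp_mk₀_of_mono K S.f
    | i + 1 =>
      apply (Ext.covariant_sequence_exact₁' K hS i (i + 1) rfl).mono_g
      have := h.1 i (by omega)
      exact ((AddCommGrpCat.isZero_of_iff_subsingleton.mpr this).eq_zero_of_src _)
  refine ⟨h1, ?_⟩
  rw [← not_subsingleton_iff_nontrivial]
  intro h2
  have h3 := h.2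
  rw [← not_subsingleton_iff_nontrivial] at h3
  apply h3
  have zero1 := AddCommGrpCat.isZero_of_iff_subsingleton.mpr (h1 c (by omega))
  have zero2 := AddCommGrpCat.isZero_of_iff_subsingleton.mpr h2
  exact AddCommGrpCat.subsingleton_of_isZero <| ShortComplex.Exact.isZero_of_both_zeros
        ((Ext.covariant_sequence_exact₃' K hS) c (c + 1) rfl)
        (zero1.eq_zero_of_src _) (zero2.eq_zero_of_tgt _)

lemma extComp {R : Type} [CommRing R] (K M : ModuleCat.{0} R) (i : ℕ) :
    Subsingleton (((_root_.Ext R (ModuleCat R) i).obj (Opposite.op K)).obj M) ↔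
      Subsingleton (Abelian.Ext K M i) := by
  let P := projectiveResolution K
  rw [((P.isoExt (R := R) i M).toLinearEquiv.toEquiv).subsingleton_congr, ← ModuleCat.isZero_iff_subsingleton,
    ← HomologicalComplex.exactAt_iff_isZero_homology]
  match i with
  | 0 =>
    rw [HomologicalComplex.exactAt_iff' _ 0 0 1 (by simp) (by simp), ShortComplex.moduleCat_exact_iff]
    rw [Ext.addEquiv₀.toEquiv.subsingleton_congr]
    have hpi : Epi (P.π.f 0) := inferInstance
    constructor
    · intro h
      refine subsingleton_of_forall_eq 0 fun f => ?_
      let fS : ((ChainComplex.single₀ (ModuleCat.{0} R)).obj K).X 0 ⟶ M := f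
      let f' : P.complex.X 0 ⟶ M := P.π.f 0 ≫ fS
      obtain ⟨g, hg⟩ := h f' (show P.complex.d 1 0 ≫ P.π.f 0 ≫ fS = 0 by
        rw [← Category.assoc, P.complex_d_comp_π_f_zero, zero_comp])
      have h0 : (P.complex.linearYonedaObj R M).d 0 0 = 0 := HomologicalComplex.shape _ _ _ (by simp)
      have h1 : f' = 0 := by
        rw [← hg]
        change (P.complex.linearYonedaObj R M).d 0 0 g = 0
        rw [h0]; rfl
      have h2 : P.π.f 0 ≫ fS = P.π.f 0 ≫ 0 := by rw [comp_zero]; exact h1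
      exact (cancel_epi (P.π.f 0)).1 h2
    · intro h f hf
      have hf' : P.complex.d 1 0 ≫ (show P.complex.X 0 ⟶ M from f) = 0 := hf
      let l := P.exact₀.desc (show P.complex.X 0 ⟶ M from f) hf'
      have h2 : P.π.f 0 ≫ l = (show P.complex.X 0 ⟶ M from f) := P.exact₀.g_desc _ hf'
      have h3 : l = 0 := Subsingleton.elim (α := K ⟶ M) _ _
      refine ⟨0, ?_⟩
      rw [h3, comp_zero] at h2
      rw [map_zero]; exact h2
  | i+1 =>
    rw [HomologicalComplex.exactAt_iff' _ i (i+1) (i+2) (by simp) (by simp), ShortComplex.moduleCat_exact_iff]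
    constructor
    · intro h
      refine subsingleton_of_forall_eq 0 fun a => ?_
      obtain ⟨f, hf, rfl⟩ := P.extMk_surjective a (i+2) rfl
      rw [P.extMk_eq_zero_iff _ _ _ _ i rfl]
      exact h f hf
    · intro h f hf
      exact (P.extMk_eq_zero_iff f (i+2) rfl hf i rfl).1 (Subsingleton.elim _ _)

section mono
open MvPolynomial

variable {k : Type} [Field k] {n : ℕ}

/-- The monomial ideal spanned by the monomials with exponents in `A`. -/
noncomputable def monIdeal (k : Type) [Field k] {n : ℕ} (A : Set (Fin n →₀ ℕ)) : Ideal (MvPolynomial (Fin n) k) :=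
  Ideal.span ((fun s => monomial s (1 : k)) '' A)

lemma mem_monIdeal {A : Set (Fin n →₀ ℕ)} (hA : IsUpperSet A) (f : MvPolynomial (Fin n) k) :
    f ∈ monIdeal k A ↔ ∀ d ∈ f.support, d ∈ A := by
  rw [monIdeal, mem_ideal_span_monomial_image]
  refine forall₂_congr fun d hd => ⟨?_, fun h => ⟨d, h, le_rfl⟩⟩
  rintro ⟨s, hs, hsd⟩
  exact hA hsd hs

lemma monomial_mem_monIdeal {A : Set (Fin n →₀ ℕ)} (hA : IsUpperSet A) (u : Fin n →₀ ℕ) :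
    (monomial u (1 : k)) ∈ monIdeal k A ↔ u ∈ A := by
  classical
  rw [mem_monIdeal hA, support_monomial]
  simp

/-- saturation with respect to the variables in `W`. -/
def Sat (W : Finset (Fin n)) (A : Set (Fin n →₀ ℕ)) : Prop :=
  ∀ i ∈ W, ∀ u, u + Finsupp.single i 1 ∈ A → u ∈ A

lemma Sat.iter {W : Finset (Fin n)} {A : Set (Fin n →₀ ℕ)} (h : Sat W A) (d : Fin n →₀ ℕ) :
    (∀ j ∉ W, d j = 0) → ∀ u, u + d ∈ A → u ∈ A := by
  induction d using Finsupp.induction_linear with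
  | zero => intro _ u hu; simpa using hu
  | add f g hf hg =>
    intro hz u hu
    have h0 : ∀ j ∉ W, f j = 0 ∧ g j = 0 := fun j hj => by simpa using hz j hj
    exact hf (fun j hj => (h0 j hj).1) _ (hg (fun j hj => (h0 j hj).2) _ (by rwa [add_assoc]))
  | single i s =>
    intro hz u hu
    by_cases hi : i ∈ W
    · clear hz
      induction s generalizing u with
      | zero => simpa using hu
      | succ s ih =>
        apply ih
        apply h i hi
        rwa [add_assoc, ← Finsupp.single_add]
    · have := hz i hi
      simp at this
      simpa [this] using hu

lemma exists_socle {W : Finset (Fin n)} {A B : Set (Fin n →₀ ℕ)} (hA : IsUpperSet A)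
    (hB : IsUpperSet B) (sB : Sat W B)
    (nil : ∀ u ∈ B, ∀ j ∉ W, ∃ s : ℕ, u + Finsupp.single j s ∈ A)
    (u₀ : Fin n →₀ ℕ) (h0B : u₀ ∈ B) (h0A : u₀ ∉ A) :
    ∃ u ∈ B, u ∉ A ∧ (∀ i ∈ W, u i = 0) ∧ ∀ j ∉ W, u + Finsupp.single j 1 ∈ A := by
  classical
  obtain ⟨u₁, h1B, h1A, h1W⟩ : ∃ u ∈ B, u ∉ A ∧ (∀ i ∈ W, u i = 0) := by
    have hd : u₀.filter (fun i => i ∉ W) + u₀.filter (fun i => ¬ i ∉ W) = u₀ :=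
      Finsupp.filter_add_filter_not _ _
    refine ⟨u₀.filter (fun i => i ∉ W), ?_, ?_, ?_⟩
    · refine sB.iter (u₀.filter (fun i => ¬ i ∉ W)) ?_ _ (by rwa [hd])
      intro j hj
      exact Finsupp.filter_apply_neg _ _ (by simpa using hj)
    · intro h
      apply h0A
      refine hA ?_ h
      nth_rewrite 2 [← hd]
      exact le_self_add
    · intro i hi
      exact Finsupp.filter_apply_neg _ _ (by simpa using hi)
  have hs : ∀ j, ∃ s : ℕ, j ∉ W → u₁ + Finsupp.single j s ∈ A := by
    intro j
    by_cases hj : j ∈ W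
    · exact ⟨0, fun h => (h hj).elim⟩
    · obtain ⟨s, hs⟩ := nil u₁ h1B j hj
      exact ⟨s, fun _ => hs⟩
  choose s hs using hs
  let Z : Set (Fin n →₀ ℕ) := {u | u₁ ≤ u ∧ u ∉ A ∧ ∀ i ∈ W, u i = 0}
  have hZ : Z.Finite := by
    refine (Set.finite_Icc (0 : Fin n →₀ ℕ) (u₁ + Finsupp.equivFunOnFinite.symm s)).subset ?_
    rintro u ⟨h1, h2, h3⟩
    refine ⟨zero_le, fun j => ?_⟩
    by_cases hj : j ∈ W
    · simp [h3 j hj]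
    · by_contra hlt
      apply h2
      refine hA ?_ (hs j hj)
      intro l
      have := h1 l
      by_cases hl : l = j
      · subst hl
        simp at hlt ⊢
        omega
      · simpa [Finsupp.single_apply, Ne.symm hl] using this
  obtain ⟨u, huZ, hmax⟩ := hZ.exists_maximal ⟨u₁, le_rfl, h1A, h1W⟩
  refine ⟨u, hB huZ.1 h1B, huZ.2.1, huZ.2.2, fun j hj => ?_⟩
  by_contra hc
  have hZ' : u + Finsupp.single j 1 ∈ Z := by
    refine ⟨huZ.1.trans le_self_add, hc, fun i hi => ?_⟩
    have : j ≠ i := by rintro rfl; exact hj hi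
    simp [huZ.2.2 i hi, Finsupp.single_apply, this]
  have := hmax hZ' le_self_add j
  simp at this

/-- `A` enlarged by the elements of `B` divisible by a variable from `T`. -/
def enl (A B : Set (Fin n →₀ ℕ)) (T : Finset (Fin n)) : Set (Fin n →₀ ℕ) :=
  {u | u ∈ A ∨ (u ∈ B ∧ ∃ i ∈ T, u i ≠ 0)}

lemma enl_upper {A B : Set (Fin n →₀ ℕ)} (hA : IsUpperSet A) (hB : IsUpperSet B)
    (T : Finset (Fin n)) : IsUpperSet (enl A B T) := by
  rintro u v huv (h | ⟨h, i, hi, h0⟩)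
  · exact Or.inl (hA huv h)
  · refine Or.inr ⟨hB huv h, i, hi, ?_⟩
    have := huv i
    omega

lemma enl_empty (A B : Set (Fin n →₀ ℕ)) : enl A B ∅ = A := by
  ext u; simp [enl]

lemma enl_mono {A B : Set (Fin n →₀ ℕ)} {T T' : Finset (Fin n)} (h : T ⊆ T') :
    enl A B T ⊆ enl A B T' := by
  rintro u (h1 | ⟨h1, i, hi, h0⟩)
  · exact Or.inl h1
  · exact Or.inr ⟨h1, i, h hi, h0⟩

lemma monIdeal_mono {A B : Set (Fin n →₀ ℕ)} (h : A ⊆ B) : monIdeal k A ≤ monIdeal k B :=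
  Ideal.span_mono (Set.image_mono h)

/-- The class of an element in the subquotient. -/
def sqMk {R M : Type} [CommRing R] [AddCommGroup M] [Module R M] (N N' : Submodule R M) :
    N' →ₗ[R] subQuot R N N' := Submodule.mkQ _

lemma sqMk_surj {R M : Type} [CommRing R] [AddCommGroup M] [Module R M] (N N' : Submodule R M) :
    Function.Surjective (sqMk N N') := Submodule.mkQ_surjective _

lemma sqMk_eq_zero {R M : Type} [CommRing R] [AddCommGroup M] [Module R M] (N N' : Submodule R M)
    (x : N') : sqMk N N' x = 0 ↔ (x : M) ∈ N := by
  unfold sqMk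
  rw [Submodule.mkQ_apply, Submodule.Quotient.mk_eq_zero]
  rfl

/-- The natural map between subquotients. -/
def sqMap {R M : Type} [CommRing R] [AddCommGroup M] [Module R M] {N₁ N₂ : Submodule R M}
    (N' : Submodule R M) (h : N₁ ≤ N₂) : subQuot R N₁ N' →ₗ[R] subQuot R N₂ N' :=
  Submodule.mapQ _ _ LinearMap.id (Submodule.comap_mono h)

lemma sqMap_mk {R M : Type} [CommRing R] [AddCommGroup M] [Module R M] {N₁ N₂ : Submodule R M}
    (N' : Submodule R M) (h : N₁ ≤ N₂) (x : N') : sqMap N' h (sqMk N₁ N' x) = sqMk N₂ N' x := rfl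

lemma X_mul_mem_iff {A : Set (Fin n →₀ ℕ)} (hA : IsUpperSet A) (i : Fin n)
    (f : MvPolynomial (Fin n) k) :
    X i * f ∈ monIdeal k A ↔ ∀ d ∈ f.support, d + Finsupp.single i 1 ∈ A := by
  rw [mem_monIdeal hA]
  constructor
  · intro h d hd
    apply h
    rw [mem_support_iff, add_comm, coeff_X_mul]
    exact mem_support_iff.1 hd
  · intro h d hd
    rw [support_X_mul] at hd
    simp only [Finset.mem_map, addLeftEmbedding_apply] at hd
    obtain ⟨e, he, rfl⟩ := hd
    rw [add_comm]
    exact h e he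

lemma X_pow_mul_mem_iff {A : Set (Fin n →₀ ℕ)} (hA : IsUpperSet A) (i : Fin n) (N : ℕ)
    (f : MvPolynomial (Fin n) k) (h : ∀ d ∈ f.support, d + Finsupp.single i N ∈ A) :
    X i ^ N * f ∈ monIdeal k A := by
  rw [mem_monIdeal hA]
  intro d hd
  rw [X_pow_eq_monomial, mem_support_iff, coeff_monomial_mul'] at hd
  split_ifs at hd with hle
  · have := h _ (mem_support_iff.2 (by simpa using hd))
    rwa [tsub_add_cancel_of_le hle] at this
  · exact absurd rfl hd

variable {W : Finset (Fin n)} {A B : Set (Fin n →₀ ℕ)}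

lemma reg_enl (hA : IsUpperSet A) (hB : IsUpperSet B) (sA : Sat W A)
    (T : Finset (Fin n)) (i : Fin n) (hi : i ∈ W) (hiT : i ∉ T) :
    IsSMulRegular (subQuot (MvPolynomial (Fin n) k) (monIdeal k (enl A B T)) (monIdeal k B))
      (X i : MvPolynomial (Fin n) k) := by
  rw [isSMulRegular_iff_right_eq_zero_of_smul]
  intro m hm
  obtain ⟨⟨f, hf⟩, rfl⟩ := sqMk_surj _ _ m
  rw [← map_smul, sqMk_eq_zero] at hm
  rw [sqMk_eq_zero]
  change X i * f ∈ _ at hm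
  change f ∈ _
  rw [X_mul_mem_iff (enl_upper hA hB T)] at hm
  rw [mem_monIdeal (enl_upper hA hB T)]
  rw [mem_monIdeal hB] at hf
  intro d hd
  rcases hm d hd with h | ⟨_, l, hl, h⟩
  · exact Or.inl (sA i hi _ h)
  · refine Or.inr ⟨hf d hd, l, hl, ?_⟩
    have : i ≠ l := by rintro rfl; exact hiT hl
    simpa [Finsupp.single_apply, this] using h

lemma ker_enl (hA : IsUpperSet A) (hB : IsUpperSet B) (sB : Sat W B)
    (T : Finset (Fin n)) (i : Fin n) (hi : i ∈ W)
    (m : subQuot (MvPolynomial (Fin n) k) (monIdeal k (enl A B T)) (monIdeal k B)) :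
    sqMap (monIdeal k B) (monIdeal_mono (enl_mono (Finset.subset_insert i T))) m = 0 ↔
      ∃ m', m = (X i : MvPolynomial (Fin n) k) • m' := by
  obtain ⟨⟨f, hf⟩, rfl⟩ := sqMk_surj _ _ m
  rw [sqMap_mk, sqMk_eq_zero]
  change f ∈ _ ↔ _
  have uT := enl_upper hA hB T
  have uT' := enl_upper hA hB (insert i T)
  have hfB := (mem_monIdeal hB f).1 hf
  constructor
  · intro h
    rw [mem_monIdeal uT'] at h
    have hq : f.divMonomial (Finsupp.single i 1) ∈ monIdeal k B := by
      rw [mem_monIdeal hB]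
      intro d hd
      rw [mem_support_iff, coeff_divMonomial] at hd
      apply sB i hi
      rw [add_comm]
      exact hfB _ (mem_support_iff.2 hd)
    refine ⟨sqMk _ _ ⟨_, hq⟩, ?_⟩
    rw [← map_smul, ← sub_eq_zero, ← map_sub, sqMk_eq_zero]
    change f - X i * f.divMonomial (Finsupp.single i 1) ∈ _
    have hmod : f - X i * f.divMonomial (Finsupp.single i 1) = f.modMonomial (Finsupp.single i 1) := by
      rw [sub_eq_iff_eq_add, add_comm, X]
      exact (divMonomial_add_modMonomial f (Finsupp.single i 1)).symm
    rw [hmod, mem_monIdeal uT]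
    intro d hd
    rw [mem_support_iff] at hd
    by_cases hle : Finsupp.single i 1 ≤ d
    · exact absurd (coeff_modMonomial_of_le _ hle) hd
    · rw [coeff_modMonomial_of_not_le _ hle] at hd
      have hdi : d i = 0 := by
        by_contra hc
        apply hle
        rw [Finsupp.single_le_iff]
        omega
      rcases h d (mem_support_iff.2 hd) with h | ⟨h1, l, hl, h2⟩
      · exact Or.inl h
      · rcases Finset.mem_insert.1 hl with rfl | hl
        · exact absurd hdi h2
        · exact Or.inr ⟨h1, l, hl, h2⟩
  · rintro ⟨m', hm'⟩
    obtain ⟨⟨g, hg⟩, rfl⟩ := sqMk_surj _ _ m'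
    rw [← map_smul, ← sub_eq_zero, ← map_sub, sqMk_eq_zero] at hm'
    change f - X i * g ∈ _ at hm'
    have h1 := monIdeal_mono (enl_mono (Finset.subset_insert i T)) hm'
    have h2 : X i * g ∈ monIdeal k (enl A B (insert i T)) := by
      rw [X_mul_mem_iff uT']
      intro d hd
      refine Or.inr ⟨hB le_self_add ((mem_monIdeal hB g).1 hg d hd), i, by simp, by simp⟩
    simpa using add_mem h1 h2

/-- The irrelevant ideal. -/
noncomputable abbrev irr (k : Type) [Field k] (n : ℕ) : Ideal (MvPolynomial (Fin n) k) :=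
  Ideal.span (Set.range (X : Fin n → MvPolynomial (Fin n) k))

lemma ext_zero_enl (hA : IsUpperSet A) (hB : IsUpperSet B) (u : Fin n →₀ ℕ) (huB : u ∈ B)
    (huA : u ∉ A) (huW : ∀ i ∈ W, u i = 0) (huj : ∀ j ∉ W, u + Finsupp.single j 1 ∈ A) :
    Nontrivial (Abelian.Ext (ModuleCat.of (MvPolynomial (Fin n) k) (MvPolynomial (Fin n) k ⧸ irr k n))
      (ModuleCat.of (MvPolynomial (Fin n) k)
        (subQuot (MvPolynomial (Fin n) k) (monIdeal k (enl A B W)) (monIdeal k B))) 0) := by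
  rw [(Ext.addEquiv₀.trans ModuleCat.homAddEquiv).toEquiv.nontrivial_congr]
  have uT := enl_upper hA hB W
  let v := sqMk (monIdeal k (enl A B W)) (monIdeal k B)
    ⟨monomial u 1, (monomial_mem_monIdeal hB u).2 huB⟩
  have hv : v ≠ 0 := by
    rw [Ne, sqMk_eq_zero]
    change ¬ monomial u (1 : k) ∈ _
    rw [monomial_mem_monIdeal uT]
    rintro (h | ⟨_, i, hi, h⟩)
    · exact huA h
    · exact h (huW i hi)
  have hker : irr k n ≤ LinearMap.ker (LinearMap.toSpanSingleton (MvPolynomial (Fin n) k) _ v) := by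
    refine Submodule.span_le.2 ?_
    rintro _ ⟨i, rfl⟩
    change (X i : MvPolynomial (Fin n) k) • v = 0
    rw [← map_smul, sqMk_eq_zero]
    change X i * monomial u (1 : k) ∈ _
    rw [X_mul_mem_iff uT]
    intro d hd
    obtain rfl : d = u := by simpa using support_monomial_subset hd
    by_cases hi : i ∈ W
    · exact Or.inr ⟨hB le_self_add huB, i, hi, by simp⟩
    · exact Or.inl (huj i hi)
  refine ⟨⟨Submodule.liftQ _ _ hker, 0, fun h => hv ?_⟩⟩
  have := LinearMap.congr_fun h (Submodule.Quotient.mk 1)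
  rw [Submodule.liftQ_apply, LinearMap.toSpanSingleton_apply, one_smul] at this
  exact this

lemma irr_ann (i : Fin n) : (X i : MvPolynomial (Fin n) k) ∈
    Module.annihilator (MvPolynomial (Fin n) k) (MvPolynomial (Fin n) k ⧸ irr k n) := by
  rw [Ideal.annihilator_quotient]
  exact Ideal.subset_span ⟨i, rfl⟩

lemma ext_enl (hA : IsUpperSet A) (hB : IsUpperSet B) (sA : Sat W A) (sB : Sat W B)
    (u : Fin n →₀ ℕ) (huB : u ∈ B)
    (huA : u ∉ A) (huW : ∀ i ∈ W, u i = 0) (huj : ∀ j ∉ W, u + Finsupp.single j 1 ∈ A)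
    (c : ℕ) : ∀ T ⊆ W, T.card + c = W.card →
    (∀ i < c, Subsingleton (Abelian.Ext
      (ModuleCat.of (MvPolynomial (Fin n) k) (MvPolynomial (Fin n) k ⧸ irr k n))
      (ModuleCat.of (MvPolynomial (Fin n) k)
        (subQuot (MvPolynomial (Fin n) k) (monIdeal k (enl A B T)) (monIdeal k B))) i)) ∧
    Nontrivial (Abelian.Ext
      (ModuleCat.of (MvPolynomial (Fin n) k) (MvPolynomial (Fin n) k ⧸ irr k n))
      (ModuleCat.of (MvPolynomial (Fin n) k)
        (subQuot (MvPolynomial (Fin n) k) (monIdeal k (enl A B T)) (monIdeal k B))) c) := by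
  induction c with
  | zero =>
    intro T hT hc
    obtain rfl : T = W := Finset.eq_of_subset_of_card_le hT (by omega)
    exact ⟨by simp, ext_zero_enl hA hB u huB huA huW huj⟩
  | succ c ih =>
    intro T hT hc
    obtain ⟨i, hi, hiT⟩ : ∃ i ∈ W, i ∉ T := by
      by_contra! hcon
      have := Finset.card_le_card (show W ⊆ T from hcon)
      omega
    refine exShift _ _ (ModuleCat.of (MvPolynomial (Fin n) k)
        (subQuot (MvPolynomial (Fin n) k) (monIdeal k (enl A B (insert i T))) (monIdeal k B))) (X i)
      (irr_ann i) (reg_enl hA hB sA T i hi hiT)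
      (sqMap (monIdeal k B) (monIdeal_mono (enl_mono (Finset.subset_insert i T)))) ?_
      (ker_enl hA hB sB T i hi) c (ih _ (Finset.insert_subset hi hT) ?_)
    · intro m
      obtain ⟨x, rfl⟩ := sqMk_surj _ _ m
      exact ⟨sqMk _ _ x, sqMap_mk _ _ _⟩
    · rw [Finset.card_insert_of_notMem hiT]
      omega

lemma mDepth_eq (R : Type) [CommRing R] (I : Ideal R) (M : Type) [AddCommGroup M] [Module R M]
    (c : ℕ) (h : (∀ i < c, Subsingleton (Abelian.Ext (ModuleCat.of R (R ⧸ I)) (ModuleCat.of R M) i)) ∧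
      Nontrivial (Abelian.Ext (ModuleCat.of R (R ⧸ I)) (ModuleCat.of R M) c)) :
    mDepth R I M = c := by
  apply le_antisymm
  · apply sInf_le
    refine ⟨c, rfl, ?_⟩
    rw [← not_subsingleton_iff_nontrivial, extComp, not_subsingleton_iff_nontrivial]
    exact h.2
  · apply le_sInf
    rintro _ ⟨j, rfl, hj⟩
    rw [← not_subsingleton_iff_nontrivial, extComp] at hj
    by_contra hc
    exact hj (h.1 j (by simpa using hc))

lemma supp_eq (hA : IsUpperSet A) (hB : IsUpperSet B) (sA : Sat W A)
    (nil : ∀ u ∈ B, ∀ j ∉ W, ∃ s : ℕ, u + Finsupp.single j s ∈ A)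
    (u : Fin n →₀ ℕ) (huB : u ∈ B) (huA : u ∉ A) :
    Module.support (MvPolynomial (Fin n) k)
      (subQuot (MvPolynomial (Fin n) k) (monIdeal k A) (monIdeal k B)) =
    PrimeSpectrum.zeroLocus (Ideal.span (X '' {j | j ∉ W}) : Ideal (MvPolynomial (Fin n) k)) := by
  ext q
  rw [Module.mem_support_iff_exists_annihilator, PrimeSpectrum.mem_zeroLocus]
  constructor
  · rintro ⟨m, hm⟩
    obtain ⟨⟨f, hf⟩, rfl⟩ := sqMk_surj _ _ m
    have hf' := (mem_monIdeal hB f).1 hf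
    refine Submodule.span_le.2 ?_
    rintro _ ⟨j, hj, rfl⟩
    have hs : ∀ d : Fin n →₀ ℕ, ∃ s, d ∈ f.support → d + Finsupp.single j s ∈ A := by
      intro d
      by_cases hd : d ∈ f.support
      · obtain ⟨s, hs⟩ := nil d (hf' d hd) j hj
        exact ⟨s, fun _ => hs⟩
      · exact ⟨0, fun h => (hd h).elim⟩
    choose s hs using hs
    have : X j ^ (f.support.sup s) * f ∈ monIdeal k A := by
      apply X_pow_mul_mem_iff hA
      intro d hd
      refine hA ?_ (hs d hd)
      gcongr
      exact Finset.le_sup hd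
    have h2 : (X j : MvPolynomial (Fin n) k) ^ (f.support.sup s) ∈ q.asIdeal := by
      apply hm
      rw [Submodule.mem_annihilator_span_singleton, ← map_smul, sqMk_eq_zero]
      exact this
    exact q.isPrime.mem_of_pow_mem _ h2
  · intro hq
    refine ⟨sqMk _ _ ⟨monomial u 1, (monomial_mem_monIdeal hB u).2 huB⟩, ?_⟩
    intro p hp
    apply hq
    rw [Submodule.mem_annihilator_span_singleton, ← map_smul, sqMk_eq_zero] at hp
    change p * monomial u (1 : k) ∈ _ at hp
    rw [mem_monIdeal hA] at hp
    change p ∈ Ideal.span _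
    rw [mem_ideal_span_X_image]
    intro d hd
    by_contra! hc
    apply huA
    apply sA.iter d hc
    apply hp
    rw [mem_support_iff, add_comm, coeff_mul_monomial]
    simpa using hd

lemma dim_quot (W : Finset (Fin n)) :
    ringKrullDim (MvPolynomial (Fin n) k ⧸
      (Ideal.span (X '' {j | j ∉ W}) : Ideal (MvPolynomial (Fin n) k))) = (W.card : WithBot ℕ∞) := by
  let P : Ideal (MvPolynomial (Fin n) k) := Ideal.span (X '' {j | j ∉ W})
  have hinj : Function.Injective (Subtype.val : W → Fin n) := Subtype.val_injective
  let φ := killCompl (R := k) hinj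
  have hsurj : Function.Surjective φ := fun p => ⟨rename Subtype.val p, killCompl_rename_app hinj p⟩
  have hX : ∀ j ∉ W, φ (X j) = 0 := by
    intro j hj
    simp only [φ, killCompl, aeval_X]
    rw [dif_neg]
    simpa using hj
  have hX' : ∀ j (hj : j ∈ W), φ (X j) = X ⟨j, hj⟩ := by
    intro j hj
    have := killCompl_rename_app (R := k) hinj (X ⟨j, hj⟩)
    simpa using this
  have hcomp : (Ideal.Quotient.mkₐ k P).comp ((rename Subtype.val).comp φ) = Ideal.Quotient.mkₐ k P := by
    apply algHom_ext
    intro j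
    by_cases hj : j ∈ W
    · simp [hX' j hj]
    · have : (Ideal.Quotient.mkₐ k P) (X j) = 0 := by
        rw [Ideal.Quotient.mkₐ_eq_mk, Ideal.Quotient.eq_zero_iff_mem]
        exact Ideal.subset_span ⟨j, hj, rfl⟩
      rw [this]
      simp [hX j hj]
  have hker : RingHom.ker φ = P := by
    apply le_antisymm
    · intro f hf
      have h1 := DFunLike.congr_fun hcomp f
      have h2 : φ f = 0 := hf
      simp only [AlgHom.comp_apply, h2, map_zero] at h1
      rw [Ideal.Quotient.mkₐ_eq_mk] at h1
      exact Ideal.Quotient.eq_zero_iff_mem.1 h1.symm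
    · refine Submodule.span_le.2 ?_
      rintro _ ⟨j, hj, rfl⟩
      exact hX j hj
  have e := Ideal.quotientKerAlgEquivOfSurjective hsurj
  change ringKrullDim (MvPolynomial (Fin n) k ⧸ P) = _
  rw [← hker, ringKrullDim_eq_of_ringEquiv e.toRingEquiv, MvPolynomial.ringKrullDim_of_isNoetherianRing,
    ringKrullDim_eq_zero_of_field]
  simp

lemma core (hA : IsUpperSet A) (hB : IsUpperSet B) (hAB : A ⊆ B) (sA : Sat W A) (sB : Sat W B)
    (nil : ∀ u ∈ B, ∀ j ∉ W, ∃ s : ℕ, u + Finsupp.single j s ∈ A) (hne : monIdeal k A ≠ monIdeal k B) :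
    IsCM (MvPolynomial (Fin n) k) (irr k n)
      (subQuot (MvPolynomial (Fin n) k) (monIdeal k A) (monIdeal k B)) ∧
    mDim (MvPolynomial (Fin n) k)
      (subQuot (MvPolynomial (Fin n) k) (monIdeal k A) (monIdeal k B)) = (W.card : WithBot ℕ∞) := by
  obtain ⟨u₀, h0B, h0A⟩ : ∃ u ∈ B, u ∉ A := by
    by_contra! h
    exact hne (by rw [Set.Subset.antisymm hAB h])
  obtain ⟨u, huB, huA, huW, huj⟩ := exists_socle hA hB sB nil u₀ h0B h0A
  have hdim : mDim (MvPolynomial (Fin n) k)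
      (subQuot (MvPolynomial (Fin n) k) (monIdeal k A) (monIdeal k B)) = (W.card : WithBot ℕ∞) := by
    rw [mDim, supp_eq hA hB sA nil u huB huA, ← ringKrullDim_quotient, dim_quot]
  refine ⟨⟨?_, ?_⟩, hdim⟩
  · refine ⟨⟨sqMk _ _ ⟨monomial u 1, (monomial_mem_monIdeal hB u).2 huB⟩, 0, ?_⟩⟩
    rw [Ne, sqMk_eq_zero]
    exact fun h => huA ((monomial_mem_monIdeal hA u).1 h)
  · have h := ext_enl (k := k) hA hB sA sB u huB huA huW huj W.card ∅ (by simp) (by simp)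
    rw [enl_empty] at h
    rw [hdim, mDepth_eq _ _ _ _ h]
    rfl

end mono

lemma refine_chain {L : Type} [PartialOrder L] (Q : ℕ → L → L → Prop) (H : L → Prop)
    (J : ℕ → L) (hH : ∀ i, H (J i)) (m : ℕ) (hle : ∀ c < m, J c ≤ J (c + 1))
    (hQ : ∀ c < m, J c ≠ J (c + 1) → Q c (J c) (J (c + 1))) :
    ∃ (r : ℕ) (F : ℕ → L) (d : ℕ → ℕ), F 0 = J 0 ∧ F r = J m ∧ (∀ i < r, F i < F (i + 1)) ∧
      (∀ i, H (F i)) ∧ (∀ i < r, Q (d i) (F i) (F (i + 1))) ∧ (∀ i < r, d i < m) ∧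
      (∀ i, i + 1 < r → d i < d (i + 1)) := by
  induction m with
  | zero => exact ⟨0, fun _ => J 0, fun _ => 0, rfl, rfl, by simp, fun _ => hH 0, by simp, by simp, by simp⟩
  | succ m ih =>
    obtain ⟨r, F, d, h0, hr, hlt, hh, hq, hd, hdd⟩ := ih (fun c hc => hle c (by omega))
      (fun c hc => hQ c (by omega))
    by_cases he : J m = J (m + 1)
    · exact ⟨r, F, d, h0, hr.trans he, hlt, hh, hq, fun i hi => (hd i hi).trans (by omega), hdd⟩
    · refine ⟨r + 1, fun i => if i ≤ r then F i else J (m + 1), fun i => if i < r then d i else m,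
        by simpa using h0, by simp, ?_, ?_, ?_, ?_, ?_⟩
      · intro i hi
        rcases Nat.lt_succ_iff_lt_or_eq.1 hi with hi | rfl
        · simpa [hi.le, hi] using hlt i hi
        · simpa [hr] using lt_of_le_of_ne (hle m (by omega)) he
      · intro i
        dsimp only
        split_ifs
        · exact hh i
        · exact hH _
      · intro i hi
        rcases Nat.lt_succ_iff_lt_or_eq.1 hi with hi | rfl
        · simpa [hi.le, hi] using hq i hi
        · simpa [hr] using hQ m (by omega) he
      · intro i hi
        dsimp only
        split_ifs with h
        · exact (hd i h).trans (by omega)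
        · omega
      · intro i hi
        have hi' : i < r := by omega
        dsimp only
        rw [if_pos hi']
        split_ifs with h
        · exact hdd i h
        · exact hd i hi'

section final
open MvPolynomial

/-- the last `c` variables -/
def lastW (n c : ℕ) : Finset (Fin n) := Finset.univ.filter fun i => n ≤ i.val + c

/-- indicator exponent of the last `c` variables -/
noncomputable def ind (n c : ℕ) : Fin n →₀ ℕ :=
  Finsupp.equivFunOnFinite.symm fun i => if n ≤ i.val + c then 1 else 0

lemma ind_apply (n c : ℕ) (i : Fin n) : ind n c i = if n ≤ i.val + c then 1 else 0 := rfl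

/-- exponents of the successive saturations -/
def satSet {k : Type} [Field k] {n : ℕ} (I : Ideal (MvPolynomial (Fin n) k)) (c : ℕ) :
    Set (Fin n →₀ ℕ) :=
  {u | c ≤ n → ∃ t : ℕ, monomial (u + t • ind n c) (1 : k) ∈ I}

variable {k : Type} [Field k] {n : ℕ} {I : Ideal (MvPolynomial (Fin n) k)}

lemma mon_le {u v : Fin n →₀ ℕ} (h : u ≤ v) (hu : monomial u (1 : k) ∈ I) :
    monomial v (1 : k) ∈ I := by
  have : monomial v (1 : k) = monomial (v - u) 1 * monomial u 1 := by
    rw [monomial_mul, tsub_add_cancel_of_le h, one_mul]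
  rw [this]
  exact I.mul_mem_left _ hu

lemma satSet_upper (c : ℕ) : IsUpperSet (satSet I c) := by
  intro u v h hu hc
  obtain ⟨t, ht⟩ := hu hc
  exact ⟨t, mon_le (by gcongr) ht⟩

lemma satSet_sat (c e : ℕ) (hce : c ≤ e) : Sat (lastW n c) (satSet I e) := by
  intro i hi u hu hc
  obtain ⟨t, ht⟩ := hu hc
  refine ⟨t + 1, mon_le ?_ ht⟩
  have hi : n ≤ i.val + c := by simpa [lastW] using hi
  intro l
  simp only [Finsupp.add_apply, Finsupp.smul_apply, ind_apply, Finsupp.single_apply, smul_eq_mul]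
  by_cases hl : i = l
  · subst hl
    rw [if_pos rfl, if_pos (by omega)]
    omega
  · rw [if_neg hl]
    split_ifs <;> omega

lemma satSet_succ (c : ℕ) : satSet I c ⊆ satSet I (c + 1) := by
  intro u hu hc
  obtain ⟨t, ht⟩ := hu (by omega)
  refine ⟨t, mon_le ?_ ht⟩
  gcongr
  intro l
  simp only [ind_apply]
  split_ifs <;> omega

lemma satSet_nil
    (hws : ∀ u : Fin n →₀ ℕ, (monomial u (1 : k) : MvPolynomial (Fin n) k) ∈ I →
      ∀ i j : Fin n, j < i → ∃ t : ℕ,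
        (monomial (u.update i 0 + Finsupp.single j t) (1 : k) : MvPolynomial (Fin n) k) ∈ I)
    (c : ℕ) (u : Fin n →₀ ℕ) (hu : u ∈ satSet I (c + 1)) (j : Fin n)
    (hj : j ∉ lastW n c) : ∃ s : ℕ, u + Finsupp.single j s ∈ satSet I c := by
  have hj : j.val + c < n := by simpa [lastW] using hj
  obtain ⟨t, ht⟩ := hu (by omega)
  by_cases hjl : j.val + c + 1 = n
  · refine ⟨t, fun _ => ⟨t, mon_le ?_ ht⟩⟩
    intro l
    simp only [Finsupp.add_apply, Finsupp.smul_apply, ind_apply, Finsupp.single_apply, smul_eq_mul]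
    by_cases hl : j = l
    · subst hl
      rw [if_pos rfl, if_pos (by omega)]
      omega
    · have : j.val ≠ l.val := fun h => hl (Fin.ext h)
      rw [if_neg hl]
      split_ifs <;> omega
  · obtain ⟨s, hs⟩ := hws _ ht ⟨n - c - 1, by omega⟩ j (by rw [Fin.lt_def]; dsimp only; omega)
    refine ⟨s, fun _ => ⟨t, mon_le ?_ hs⟩⟩
    intro l
    rw [Finsupp.add_apply, Finsupp.update_apply]
    simp only [Finsupp.add_apply, Finsupp.smul_apply, ind_apply, smul_eq_mul]
    by_cases hl : l = ⟨n - c - 1, by omega⟩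
    · rw [if_pos hl]
      omega
    · have : l.val ≠ n - c - 1 := fun h => hl (Fin.ext h)
      rw [if_neg hl]
      split_ifs <;> omega

lemma lastW_card (c : ℕ) (hc : c ≤ n) : (lastW n c).card = c := by
  induction c with
  | zero =>
    rw [Finset.card_eq_zero, lastW, Finset.filter_eq_empty_iff]
    intro i _
    have := i.2
    omega
  | succ c ih =>
    have h : lastW n (c + 1) = insert ⟨n - c - 1, by omega⟩ (lastW n c) := by
      ext i
      simp only [lastW, Finset.mem_filter, Finset.mem_univ, true_and, Finset.mem_insert, Fin.ext_iff]
      omega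
    rw [h, Finset.card_insert_of_notMem, ih (by omega)]
    simp only [lastW, Finset.mem_filter, Finset.mem_univ, true_and]
    omega

lemma satSet_zero (hmono : ∀ f ∈ I, ∀ d ∈ f.support, (monomial d (1 : k) : MvPolynomial (Fin n) k) ∈ I) :
    monIdeal k (satSet I 0) = I := by
  have h0 : ind n 0 = 0 := by
    ext i
    have := i.2
    rw [ind_apply, if_neg (by omega)]
    rfl
  have h1 : ∀ u, u ∈ satSet I 0 ↔ monomial u (1 : k) ∈ I := by
    intro u
    simp [satSet, h0]
  ext f
  rw [mem_monIdeal (satSet_upper 0)]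
  constructor
  · intro h
    rw [f.as_sum]
    refine Ideal.sum_mem _ fun d hd => ?_
    have h2 := I.mul_mem_left (C (coeff d f)) ((h1 d).1 (h d hd))
    rwa [C_mul_monomial, mul_one] at h2
  · intro hf d hd
    exact (h1 d).2 (hmono f hf d hd)

lemma monIdeal_homog {A : Set (Fin n →₀ ℕ)} (hA : IsUpperSet A) (f : MvPolynomial (Fin n) k)
    (hf : f ∈ monIdeal k A) (d : ℕ) : homogeneousComponent d f ∈ monIdeal k A := by
  rw [mem_monIdeal hA] at hf ⊢
  intro e he
  apply hf
  rw [mem_support_iff, coeff_homogeneousComponent] at he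
  rw [mem_support_iff]
  intro h
  simp [h] at he

end final

open MvPolynomial in
/-- If `I` is a weakly stable monomial ideal of `S = k[x_1, …, x_n]`, then
`S/I` is sequentially Cohen-Macaulay.  The sCM filtration of graded submodules of `S/I` is
encoded by a chain of homogeneous ideals `I = J 0 ⊊ J 1 ⊊ ⋯ ⊊ J r = S`, whose successive
quotients `J (i+1) / J i` (the quotients of the corresponding filtration of `S/I`)
are Cohen-Macaulay with strictly increasing dimensions. -/
theorem stmt2 (k : Type) [Field k] (n : ℕ) (I : Ideal (MvPolynomial (Fin n) k))
    -- `I` is a monomial ideal: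
    (hmono : ∀ f ∈ I, ∀ d ∈ f.support, (monomial d (1 : k) : MvPolynomial (Fin n) k) ∈ I)
    -- `I` is weakly stable:
    (hws : ∀ u : Fin n →₀ ℕ, (monomial u (1 : k) : MvPolynomial (Fin n) k) ∈ I →
      ∀ i j : Fin n, j < i → ∃ t : ℕ,
        (monomial (u.update i 0 + Finsupp.single j t) (1 : k) : MvPolynomial (Fin n) k) ∈ I) :
    ∃ (r : ℕ) (J : ℕ → Ideal (MvPolynomial (Fin n) k)),
      J 0 = I ∧ J r = ⊤ ∧
      (∀ i < r, J i < J (i + 1)) ∧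
      (∀ i ≤ r, ∀ f ∈ J i, ∀ d : ℕ, homogeneousComponent d f ∈ J i) ∧
      (∀ i < r,
        IsCM (MvPolynomial (Fin n) k)
          (Ideal.span (Set.range (X : Fin n → MvPolynomial (Fin n) k)))
          (subQuot (MvPolynomial (Fin n) k) (J i) (J (i + 1)))) ∧
      (∀ i, i + 1 < r →
        mDim (MvPolynomial (Fin n) k) (subQuot (MvPolynomial (Fin n) k) (J i) (J (i + 1))) <
          mDim (MvPolynomial (Fin n) k)
            (subQuot (MvPolynomial (Fin n) k) (J (i + 1)) (J (i + 2)))) := by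
  obtain ⟨r, F, d, h0, hr, hlt, hh, hq, hd, hdd⟩ := refine_chain
    (fun c N N' => IsCM (MvPolynomial (Fin n) k) (irr k n) (subQuot (MvPolynomial (Fin n) k) N N') ∧
      mDim (MvPolynomial (Fin n) k) (subQuot (MvPolynomial (Fin n) k) N N') = (c : WithBot ℕ∞))
    (fun N : Ideal (MvPolynomial (Fin n) k) => ∀ f ∈ N, ∀ d : ℕ, homogeneousComponent d f ∈ N)
    (fun c => monIdeal k (satSet I c)) (fun i => monIdeal_homog (satSet_upper i)) (n + 1)
    (fun c _ => monIdeal_mono (satSet_succ c)) (fun c hc hne => by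
      have h := core (satSet_upper c) (satSet_upper (c + 1)) (satSet_succ c)
        (satSet_sat c c le_rfl) (satSet_sat c (c + 1) (by omega)) (satSet_nil hws c) hne
      rwa [lastW_card c (by omega)] at h)
  refine ⟨r, F, h0.trans (satSet_zero hmono), ?_, hlt, fun i _ => hh i, fun i hi => (hq i hi).1, ?_⟩
  · rw [hr, Ideal.eq_top_iff_one]
    refine (monomial_mem_monIdeal (satSet_upper (n + 1)) 0).2 (fun h => ?_)
    omega
  · intro i hi
    rw [(hq i (by omega)).2, (hq (i + 1) hi).2]
    exact_mod_cast hdd i hi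
end

section
/- Let M be a d-dimensional finitely generated R-module. If M has a CM filtration 0 = C_{-1} ⊆ C_0 ⊆ C_1 ⊆ … ⊆ C_d = M, then C_i = δ_i(M) for every i ∈ {0,…,d}; in particular a CM filtration, if it exists, is unique and coincides with the dimension filtration. -/
open CategoryTheory

namespace Stmt6

open IsLocalRing Pointwise

/-- Elementwise form of the vanishing of `Ext^j`, computed with a resolution `P`. -/
def Van {R : Type} [CommRing R] {A : ModuleCat.{0} R} (P : ProjectiveResolution A)
    (j : ℕ) (B : ModuleCat.{0} R) : Prop :=
  ∀ f : P.complex.X j ⟶ B, P.complex.d (j + 1) j ≫ f = 0 →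
    ∃ g : P.complex.X (j - 1) ⟶ B, f = P.complex.d j (j - 1) ≫ g

lemma van_of_ext {R : Type} [CommRing R] {A : ModuleCat.{0} R} (P : ProjectiveResolution A)
    (j : ℕ) (B : ModuleCat.{0} R)
    (h : Subsingleton (((Ext R (ModuleCat.{0} R) j).obj (Opposite.op A)).obj B)) :
    Van P j B := by
  have h0 : Limits.IsZero ((P.complex.linearYonedaObj R B).homology j) :=
    Limits.IsZero.of_iso (ModuleCat.isZero_of_subsingleton _) (P.isoExt j B).symm
  rw [← HomologicalComplex.exactAt_iff_isZero_homology,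
    HomologicalComplex.exactAt_iff' _ (j - 1) j (j + 1) (by cases j <;> simp) (by simp),
    ShortComplex.moduleCat_exact_iff] at h0
  intro f hf
  obtain ⟨g, hg⟩ := h0 f hf
  exact ⟨g, hg.symm⟩

lemma van_quot {R : Type} [CommRing R] {A : ModuleCat.{0} R} (P : ProjectiveResolution A)
    (j : ℕ) (S : ShortComplex (ModuleCat.{0} R)) (hS : S.ShortExact)
    (h1 : Van P (j + 1) S.X₁) (h2 : Van P j S.X₂) : Van P j S.X₃ := by
  intro f hf
  have := hS.mono_f
  have := hS.epi_g
  have : Projective (P.complex.X j) := P.projective j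
  let g' := Projective.factorThru f S.g
  have hg' : g' ≫ S.g = f := Projective.factorThru_comp f S.g
  let h := hS.exact.lift (P.complex.d (j + 1) j ≫ g') (by simp [hg', hf])
  have hh : h ≫ S.f = P.complex.d (j + 1) j ≫ g' := hS.exact.lift_f _ _
  obtain ⟨h', hh'⟩ : ∃ h' : P.complex.X j ⟶ S.X₁, h = P.complex.d (j + 1) j ≫ h' := h1 h (by
    rw [← cancel_mono S.f, Category.assoc, hh]; simp)
  obtain ⟨k, hk⟩ := h2 (g' - h' ≫ S.f) (by
    rw [Preadditive.comp_sub, ← hh, hh']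
    exact sub_eq_zero.2 (Category.assoc _ _ _))
  refine ⟨k ≫ S.g, ?_⟩
  rw [← Category.assoc, ← hk, Preadditive.sub_comp, hg']
  simp

lemma hom_zero {R : Type} [CommRing R] {A : ModuleCat.{0} R} (P : ProjectiveResolution A)
    (B : ModuleCat.{0} R) (h : Van P 0 B) (u : A ⟶ B) : u = 0 := by
  have e : P.π.f 0 ≫ ((HomologicalComplex.singleObjXSelf (ComplexShape.down ℕ) 0 A).hom ≫ u) = 0 := by
    obtain ⟨g, hg⟩ := h (P.π.f 0 ≫ ((HomologicalComplex.singleObjXSelf (ComplexShape.down ℕ) 0 A).hom ≫ u)) (by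
      rw [← Category.assoc]
      exact (congrArg (· ≫ _) P.complex_d_comp_π_f_zero).trans Limits.zero_comp)
    rw [hg]; simp
  rw [← cancel_epi (P.π.f 0 ≫ (HomologicalComplex.singleObjXSelf (ComplexShape.down ℕ) 0 A).hom)]
  rw [Category.assoc, Limits.comp_zero]
  exact e

lemma key {R : Type} [CommRing R] [IsNoetherianRing R] [IsLocalRing R]
    (P : ProjectiveResolution (ModuleCat.of R (R ⧸ maximalIdeal R))) (n : ℕ) :
    ∀ (B : Type) [AddCommGroup B] [Module R B] [Module.Finite R B],
      (∀ j < n, Van P j (ModuleCat.of R B)) → ∀ K : Submodule R B, K ≠ ⊥ →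
        (n : WithBot ℕ∞) ≤ mDim R K := by
  induction n with
  | zero =>
    intro B _ _ _ _ K hK
    have : Nontrivial K := Submodule.nontrivial_iff_ne_bot.2 hK
    have : Nonempty (Module.support R K) := Module.nonempty_support_of_nontrivial.to_subtype
    exact Order.krullDim_nonneg
  | succ n ih =>
    intro B _ _ _ hV K hK
    have hsub : Subsingleton ((R ⧸ maximalIdeal R) →ₗ[R] B) := by
      refine subsingleton_of_forall_eq 0 fun u => ?_
      have := hom_zero P (ModuleCat.of R B) (hV 0 (by omega)) (ModuleCat.ofHom u)
      exact congrArg ModuleCat.Hom.hom this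
    obtain ⟨x, hx, hreg⟩ := IsSMulRegular.subsingleton_linearMap_iff.mp hsub
    rw [Ideal.annihilator_quotient] at hx
    obtain ⟨L, ⟨hKL, hL⟩, hmax⟩ := (wellFounded_gt (α := Submodule R B)).has_min
      {L | K ≤ L ∧ mDim R L ≤ mDim R K} ⟨K, le_rfl, le_rfl⟩
    have hLbot : L ≠ ⊥ := fun h => hK (le_bot_iff.1 (h ▸ hKL))
    -- `L` is saturated with respect to `x`
    have hsat : ∀ b : B, x • b ∈ L → b ∈ L := by
      intro b hb
      by_contra hbL
      let L' : Submodule R B := L.comap (LinearMap.lsmul R B x)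
      have hLL' : L ≤ L' := fun y hy => L.smul_mem x hy
      refine hmax L' ⟨hKL.trans hLL', le_trans ?_ hL⟩
        (lt_of_le_of_ne hLL' fun h => hbL (by rw [h]; exact hb))
      refine Module.supportDim_le_of_injective
        ((LinearMap.lsmul R B x).restrict (p := L') (q := L) fun y hy => hy) ?_
      intro a b hab
      exact Subtype.ext (hreg (congrArg Subtype.val hab))
    let π : B →ₗ[R] QuotSMulTop x B := Submodule.mkQ _
    let φ : QuotSMulTop x L →ₗ[R] QuotSMulTop x B :=
      Submodule.liftQ _ (π.comp L.subtype) (by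
        intro y hy
        obtain ⟨z, -, rfl⟩ := (Submodule.mem_smul_pointwise_iff_exists _ _ _).1 hy
        rw [LinearMap.mem_ker]
        exact (Submodule.Quotient.mk_eq_zero _).2
          (Submodule.smul_mem_pointwise_smul (z : B) x ⊤ trivial))
    have hφ : LinearMap.range φ ≠ ⊥ := by
      intro h
      rw [LinearMap.range_eq_bot] at h
      refine hLbot (Submodule.eq_bot_of_le_smul_of_le_jacobson_bot (maximalIdeal R) L
        (IsNoetherian.noetherian L) ?_ (IsLocalRing.maximalIdeal_le_jacobson _))
      intro y hy
      have h1 : φ (Submodule.Quotient.mk ⟨y, hy⟩) = 0 := by rw [h]; rfl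
      have h2 : y ∈ x • (⊤ : Submodule R B) := (Submodule.Quotient.mk_eq_zero _).1 h1
      obtain ⟨b, -, rfl⟩ := (Submodule.mem_smul_pointwise_iff_exists _ _ _).1 h2
      exact Submodule.smul_mem_smul hx (hsat b hy)
    have h1 : (n : WithBot ℕ∞) ≤ mDim R (LinearMap.range φ) := by
      refine ih (QuotSMulTop x B) ?_ _ hφ
      intro j hj
      exact van_quot P j _ (IsSMulRegular.smulShortComplex_shortExact
        (M := ModuleCat.of R B) hreg) (hV (j + 1) (by omega)) (hV j (by omega))
    have h2 : mDim R (LinearMap.range φ) ≤ Module.supportDim R (QuotSMulTop x L) :=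
      Module.supportDim_le_of_surjective φ.rangeRestrict φ.surjective_rangeRestrict
    have h3 : Module.supportDim R (QuotSMulTop x L) + 1 = Module.supportDim R L :=
      Module.supportDim_quotSMulTop_succ_eq_supportDim
        (fun a b hab => Subtype.ext (hreg (congrArg Subtype.val hab))) hx
    refine le_trans ?_ hL
    change _ ≤ Module.supportDim R L
    rw [← h3]
    push_cast
    gcongr
    exact h1.trans h2

lemma dim_le_of_exact {R : Type} [CommRing R] {A B C : Type} [AddCommGroup A] [Module R A]
    [AddCommGroup B] [Module R B] [AddCommGroup C] [Module R C] (f : A →ₗ[R] B) (g : B →ₗ[R] C)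
    (hf : Function.Injective f) (hg : Function.Surjective g) (h : Function.Exact f g)
    (n : WithBot ℕ∞) (hA : mDim R A ≤ n) (hC : mDim R C ≤ n) : mDim R B ≤ n := by
  have hs := Module.support_of_exact h hf hg
  refine iSup_le fun p => ?_
  have aux : ∀ S : Set (PrimeSpectrum R), (∀ q q' : PrimeSpectrum R, q ≤ q' → q ∈ S → q' ∈ S) →
      p.head.1 ∈ S → Order.krullDim S ≤ n → (p.length : WithBot ℕ∞) ≤ n := by
    intro S hS hp hn
    refine le_trans ?_ hn
    let q : LTSeries S := ⟨p.length, fun i => ⟨(p i).1, hS _ _ (p.head_le i) hp⟩,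
      fun i => p.step i⟩
    exact le_iSup (fun q : LTSeries S => (q.length : WithBot ℕ∞)) q
  have hp : p.head.1 ∈ Module.support R A ∪ Module.support R C := hs ▸ p.head.2
  rcases hp with hp | hp
  · exact aux _ (fun _ _ => Module.mem_support_mono) hp hA
  · exact aux _ (fun _ _ => Module.mem_support_mono) hp hC

end Stmt6

open IsLocalRing in
/-- (Schenzel)  Let `M` be a `d`-dimensional finitely generated module over a
Noetherian local ring `R`.  If `M` has a CM filtration `0 = C_{-1} ⊆ C_0 ⊆ ⋯ ⊆ C_d = M`
(each `C_i/C_{i-1}` zero or Cohen-Macaulay of dimension `i`), then `C_i = δ_i(M)` for every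
`0 ≤ i ≤ d`; in particular a CM filtration is unique and is the dimension filtration.
(Here the filtration is reindexed: `C' i` denotes `C_{i-1}`, so `C' 0 = C_{-1} = 0`.) -/
theorem stmt6 (R : Type) [CommRing R] [IsNoetherianRing R] [IsLocalRing R]
    (M : Type) [AddCommGroup M] [Module R M] [Module.Finite R M]
    (d : ℕ) (hd : mDim R M = (d : WithBot ℕ∞))
    (C' : ℕ → Submodule R M)
    (hbot : C' 0 = ⊥) (htop : C' (d + 1) = ⊤)
    (hmono : ∀ i ≤ d, C' i ≤ C' (i + 1))
    (hCM : ∀ i ≤ d,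
      Subsingleton (subQuot R (C' i) (C' (i + 1))) ∨
        (IsCM R (maximalIdeal R) (subQuot R (C' i) (C' (i + 1))) ∧
          mDim R (subQuot R (C' i) (C' (i + 1))) = (i : WithBot ℕ∞))) :
    ∀ i ≤ d, C' (i + 1) = deltaSub R M i := by
  have P : ProjectiveResolution (ModuleCat.of R (R ⧸ maximalIdeal R)) :=
    projectiveResolution _
  have hdim : ∀ i, i ≤ d + 1 → ∀ e : ℕ, i ≤ e + 1 →
      mDim R (C' i) ≤ (e : WithBot ℕ∞) := by
    intro i
    induction i with
    | zero =>
      intro _ e _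
      rw [hbot]
      refine le_trans (le_of_eq ?_) bot_le
      exact Module.supportDim_eq_bot_of_subsingleton R _
    | succ i ih =>
      intro hi e he
      refine Stmt6.dim_le_of_exact (Submodule.inclusion (hmono i (by omega)))
        (Submodule.mkQ (Submodule.comap (C' (i + 1)).subtype (C' i)))
        (Submodule.inclusion_injective _) (Submodule.mkQ_surjective _) ?_ _
        (ih (by omega) e (by omega)) ?_
      · rw [LinearMap.exact_iff, Submodule.ker_mkQ, Submodule.range_inclusion]
      · rcases hCM i (by omega) with h | h
        · refine le_trans (le_of_eq ?_) bot_le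
          exact Module.supportDim_eq_bot_of_subsingleton R _
        · rw [h.2]
          exact_mod_cast (by omega : i ≤ e)
  intro i hi
  apply le_antisymm
  · exact le_sSup (hdim (i + 1) (by omega) i le_rfl)
  · refine sSup_le fun N hN => ?_
    have hN : mDim R N ≤ (i : WithBot ℕ∞) := hN
    have main : ∀ k, k ≤ d - i → N ≤ C' (d - k + 1) := by
      intro k
      induction k with
      | zero => intro _; simp [htop]
      | succ k ih =>
        intro hk
        have hNj := ih (by omega)
        obtain ⟨j, hj⟩ : ∃ j, j = d - k := ⟨_, rfl⟩
        have e : d - (k + 1) + 1 = j := by omega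
        rw [e]
        rw [← hj] at hNj
        have hij : i < j := by omega
        rcases hCM j (by omega) with h | ⟨⟨_, h1⟩, h2⟩
        · intro y hy
          have h6 : (Submodule.Quotient.mk ⟨y, hNj hy⟩ : subQuot R (C' j) (C' (j + 1))) = 0 :=
            h.elim _ _
          have h7 := (Submodule.Quotient.mk_eq_zero _).1 h6
          exact h7
        · let ψ : N →ₗ[R] subQuot R (C' j) (C' (j + 1)) :=
            (Submodule.mkQ _).comp (Submodule.inclusion hNj)
          have hψ : LinearMap.range ψ = ⊥ := by
            by_contra hne
            have hdep : mDepth R (maximalIdeal R) (subQuot R (C' j) (C' (j + 1))) = (j : ℕ∞) := by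
              rw [h2] at h1
              exact_mod_cast h1
            have := Stmt6.key P j (subQuot R (C' j) (C' (j + 1))) (by
              intro l hl
              refine Stmt6.van_of_ext P l _ ?_
              by_contra hns
              have hle : mDepth R (maximalIdeal R) (subQuot R (C' j) (C' (j + 1))) ≤ (l : ℕ∞) :=
                sInf_le ⟨l, rfl, not_subsingleton_iff_nontrivial.1 hns⟩
              rw [hdep] at hle
              have : j ≤ l := by exact_mod_cast hle
              omega) _ hne
            have h4 : mDim R (LinearMap.range ψ) ≤ mDim R N :=
              Module.supportDim_le_of_surjective ψ.rangeRestrict ψ.surjective_rangeRestrict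
            have h5 : (j : WithBot ℕ∞) ≤ (i : WithBot ℕ∞) := this.trans (h4.trans hN)
            have : j ≤ i := by exact_mod_cast h5
            omega
          rw [LinearMap.range_eq_bot] at hψ
          intro y hy
          have h6 : ψ ⟨y, hy⟩ = 0 := by rw [hψ]; rfl
          have h7 := (Submodule.Quotient.mk_eq_zero
            (Submodule.comap (C' (j + 1)).subtype (C' j))).1 h6
          exact h7
    have := main (d - i) le_rfl
    rwa [Nat.sub_sub_self hi] at this
end

section
/- Let M be a finitely generated R-module. Then M is sequentially Cohen-Macaulay if and only if M is Cohen-Macaulay filtered, i.e., every quotient δ_i(M)/δ_{i-1}(M) of the dimension filtration is either zero or Cohen-Macaulay. Moreover, if M is sequentially Cohen-Macaulay, then its sCM filtration is unique. -/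
open CategoryTheory

section aux
open IsLocalRing Pointwise

variable {R : Type} [CommRing R]

lemma aux_ext (A B : Type) [AddCommGroup A] [Module R A] [AddCommGroup B] [Module R B] (n : ℕ)
    (h : Subsingleton (extC R n A B)) :
    Subsingleton (Abelian.Ext (ModuleCat.of R A) (ModuleCat.of R B) n) := by
  let P := projectiveResolution (ModuleCat.of R A)
  have h1 : Limits.IsZero ((P.complex.linearYonedaObj R (ModuleCat.of R B)).homology n) :=
    (ModuleCat.isZero_of_subsingleton _).of_iso (P.isoExt n (ModuleCat.of R B)).symm
  rw [← HomologicalComplex.exactAt_iff_isZero_homology] at h1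
  refine subsingleton_of_forall_eq 0 fun α => ?_
  obtain ⟨f, hf, rfl⟩ := P.extMk_surjective α (n + 1) rfl
  cases n with
  | zero =>
    rw [HomologicalComplex.exactAt_iff' _ 0 0 1 (by simp) (by simp),
      ShortComplex.moduleCat_exact_iff] at h1
    obtain ⟨g, hg⟩ := h1 f hf
    have : f = 0 := by
      rw [← hg]
      have h0 : ((P.complex.linearYonedaObj R (ModuleCat.of R B)).sc' 0 0 1).f = 0 :=
        (P.complex.linearYonedaObj R (ModuleCat.of R B)).shape 0 0 (fun h => absurd (show 0 + 1 = 0 from h) (by omega))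
      rw [h0]; rfl
    subst this
    simp
  | succ m =>
    rw [HomologicalComplex.exactAt_iff' _ m (m+1) (m+2) (ComplexShape.prev_eq' _ rfl) (ComplexShape.next_eq' _ rfl),
      ShortComplex.moduleCat_exact_iff] at h1
    obtain ⟨g, hg⟩ := h1 f hf
    rw [P.extMk_eq_zero_iff _ _ _ _ m rfl]
    exact ⟨g, hg⟩

variable [IsNoetherianRing R] [IsLocalRing R]

lemma aux_reg (rs : List R) : ∀ (M : Type) [AddCommGroup M] [Module R M] [Module.Finite R M]
    (_ : ∀ r ∈ rs, r ∈ maximalIdeal R) (_ : RingTheory.Sequence.IsRegular M rs)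
    (N : Submodule R M) (_ : N ≠ ⊥), ((rs.length : ℕ∞) : WithBot ℕ∞) ≤ Module.supportDim R N := by
  induction rs with
  | nil =>
    intro M _ _ _ _ _ N hN
    have : Nontrivial N := Submodule.nontrivial_iff_ne_bot.mpr hN
    have h := Module.supportDim_ne_bot_of_nontrivial R N
    obtain ⟨a, ha⟩ := WithBot.ne_bot_iff_exists.mp h
    rw [← ha]
    simp
  | cons x rs ih =>
    intro M _ _ _ hmem hreg N hN
    rw [RingTheory.Sequence.isRegular_cons_iff] at hreg
    let I := Module.annihilator R N
    let N' : Submodule R M := Submodule.torsionBySet R M (I : Set R)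
    have hNN' : N ≤ N' := by
      intro m hm
      rw [Submodule.mem_torsionBySet_iff]
      rintro ⟨a, ha⟩
      have := Module.mem_annihilator.mp ha ⟨m, hm⟩
      simpa using congrArg Subtype.val this
    have hI : I ≤ Module.annihilator R N' := by
      intro a ha
      rw [Module.mem_annihilator]
      rintro ⟨m, hm⟩
      rw [Submodule.mem_torsionBySet_iff] at hm
      exact Subtype.ext (hm ⟨a, ha⟩)
    have hdim : Module.supportDim R N' ≤ Module.supportDim R N := by
      rw [Module.supportDim, Module.supportDim]
      refine Order.krullDim_le_of_strictMono (β := Module.support R N)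
        (fun p => ⟨p.1, ?_⟩) (fun a b h => h)
      have := p.2
      rw [Module.mem_support_iff_of_finite] at this ⊢
      exact hI.trans this
    have hN'0 : Nontrivial N' := by
      rw [Submodule.nontrivial_iff_ne_bot]
      rintro h
      exact hN (le_bot_iff.mp (h ▸ hNN'))
    have hx : x ∈ maximalIdeal R := hmem x (by simp)
    have hregN : IsSMulRegular N' x := by
      intro a b hab
      exact Subtype.ext (hreg.1 (by simpa using congrArg Subtype.val hab))
    have hsucc := Module.supportDim_quotSMulTop_succ_eq_supportDim hregN hx
    let φ : QuotSMulTop x N' →ₗ[R] QuotSMulTop x M :=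
      Submodule.mapQ _ _ N'.subtype (by
        intro m hm
        rw [Submodule.mem_smul_pointwise_iff_exists] at hm
        obtain ⟨b, -, rfl⟩ := hm
        exact Submodule.smul_mem_pointwise_smul _ _ _ trivial)
    have hφ : Function.Injective φ := by
      rw [← LinearMap.ker_eq_bot, LinearMap.ker_eq_bot']
      intro y hy
      obtain ⟨m, rfl⟩ := Submodule.mkQ_surjective _ y
      have hy' : (m : M) ∈ x • (⊤ : Submodule R M) := by
        simpa [φ] using hy
      rw [Submodule.mem_smul_pointwise_iff_exists] at hy'
      obtain ⟨b, -, hb⟩ := hy'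
      have hbN : b ∈ N' := by
        rw [Submodule.mem_torsionBySet_iff]
        rintro ⟨a, ha⟩
        apply hreg.1
        have hm := m.2
        rw [Submodule.mem_torsionBySet_iff] at hm
        have := hm ⟨a, ha⟩
        rw [← hb] at this
        change a • x • b = 0 at this
        change x • a • b = x • (0 : M)
        rw [smul_comm, this, smul_zero]
      simp only [Submodule.mkQ_apply, Submodule.Quotient.mk_eq_zero]
      rw [Submodule.mem_smul_pointwise_iff_exists]
      exact ⟨⟨b, hbN⟩, trivial, Subtype.ext hb⟩
    have hne : Nontrivial (QuotSMulTop x N') := by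
      by_contra hcon
      rw [not_nontrivial_iff_subsingleton] at hcon
      rw [(Module.supportDim_eq_bot_iff_subsingleton R (QuotSMulTop x N')).mpr hcon] at hsucc
      exact Module.supportDim_ne_bot_of_nontrivial R N' hsucc.symm
    have hrange : LinearMap.range φ ≠ ⊥ := by
      intro h
      rw [LinearMap.range_eq_bot] at h
      obtain ⟨a, ha⟩ := exists_ne (0 : QuotSMulTop x N')
      exact ha (hφ (by simp [h]))
    have := ih (QuotSMulTop x M) (fun r hr => hmem r (by simp [hr])) hreg.2 _ hrange
    rw [← Module.supportDim_eq_of_equiv (LinearEquiv.ofInjective φ hφ)] at this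
    refine le_trans ?_ hdim
    rw [← hsucc]
    calc _ = ((rs.length : ℕ∞) : WithBot ℕ∞) + 1 := by simp
      _ ≤ _ := by gcongr

lemma aux_cm (Q : Type) [AddCommGroup Q] [Module R Q] [Module.Finite R Q]
    (h : IsCM R (maximalIdeal R) Q) (L : Submodule R Q) (hL : L ≠ ⊥) : mDim R Q ≤ mDim R L := by
  obtain ⟨hn, hd⟩ := h
  have key : ∀ n : ℕ, (n : ℕ∞) ≤ mDepth R (maximalIdeal R) Q →
      ((n : ℕ∞) : WithBot ℕ∞) ≤ mDim R L := by
    intro n hn'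
    have hE : ∀ i < n, Subsingleton
        (Abelian.Ext (ModuleCat.of R (R ⧸ maximalIdeal R)) (ModuleCat.of R Q) i) := by
      intro i hi
      apply aux_ext
      by_contra hcon
      rw [not_subsingleton_iff_nontrivial] at hcon
      have : mDepth R (maximalIdeal R) Q ≤ i := sInf_le ⟨i, rfl, hcon⟩
      have := hn'.trans this
      simp at this
      omega
    have hlt : maximalIdeal R • (⊤ : Submodule R Q) < ⊤ := by
      rw [lt_top_iff_ne_top]
      intro hcon
      exact (top_ne_bot : (⊤ : Submodule R Q) ≠ ⊥) (Submodule.eq_bot_of_le_smul_of_le_jacobson_bot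
        (maximalIdeal R) ⊤ Module.Finite.fg_top hcon.ge (maximalIdeal_le_jacobson _))
    obtain ⟨rs, hl, hm, hr⟩ := ModuleCat.exists_isRegular_of_exists_subsingleton_ext
      (maximalIdeal R) n (ModuleCat.of R Q) hlt (ModuleCat.of R (R ⧸ maximalIdeal R))
      (by simp [Module.support_eq_zeroLocus, Ideal.annihilator_quotient]) hE
    have := aux_reg rs Q hm hr L hL
    rwa [hl] at this
  rw [← hd]
  have : Nontrivial L := Submodule.nontrivial_iff_ne_bot.mpr hL
  obtain ⟨a, ha⟩ := WithBot.ne_bot_iff_exists.mp (Module.supportDim_ne_bot_of_nontrivial R L)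
  change _ ≤ Module.supportDim R L
  change ∀ n : ℕ, _ → _ ≤ Module.supportDim R L at key
  rw [← ha] at key ⊢
  rw [WithBot.coe_le_coe]
  exact ENat.forall_natCast_le_iff_le.mp fun n hn => WithBot.coe_le_coe.mp (key n hn)

end aux

section aux2
open IsLocalRing

variable {R : Type} [CommRing R]

/-- dimension of a subquotient -/
noncomputable def qd {M : Type} [AddCommGroup M] [Module R M] (A B : Submodule R M) : WithBot ℕ∞ :=
  mDim R (subQuot R A B)

lemma aux_union {α : Type*} [Preorder α] (S A B : Set α) (hS : S ⊆ A ∪ B)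
    (hA : IsUpperSet A) (hB : IsUpperSet B) :
    Order.krullDim S ≤ max (Order.krullDim A) (Order.krullDim B) := by
  refine iSup_le fun p => ?_
  rcases hS p.head.2 with h | h
  · refine le_trans ?_ (le_max_left _ _)
    exact (Order.LTSeries.length_le_krullDim (α := A) (LTSeries.mk p.length
      (fun i => ⟨(p i).1, hA (p.monotone (Fin.zero_le i)) h⟩) (fun i j hij => p.strictMono hij)))
  · refine le_trans ?_ (le_max_right _ _)
    exact (Order.LTSeries.length_le_krullDim (α := B) (LTSeries.mk p.length
      (fun i => ⟨(p i).1, hB (p.monotone (Fin.zero_le i)) h⟩) (fun i j hij => p.strictMono hij)))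

variable {M : Type} [AddCommGroup M] [Module R M]

lemma mDim_mono {A B : Submodule R M} (h : A ≤ B) : mDim R A ≤ mDim R B :=
  Module.supportDim_le_of_injective (Submodule.inclusion h) (Submodule.inclusion_injective h)

lemma qd_le (A B : Submodule R M) : qd A B ≤ mDim R B :=
  Module.supportDim_le_of_surjective (Submodule.mkQ _) (Submodule.mkQ_surjective _)

lemma mDim_le_max {A B : Submodule R M} (h : A ≤ B) : mDim R B ≤ max (mDim R A) (qd A B) := by
  refine aux_union _ _ _ (Eq.subset ?_) ?_ ?_
  · exact Module.support_of_exact (f := Submodule.inclusion h) (g := Submodule.mkQ _)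
      (by
        intro y
        simp only [Submodule.mkQ_apply, Submodule.Quotient.mk_eq_zero, Submodule.mem_comap,
          Set.mem_range]
        exact ⟨fun hy => ⟨⟨y, hy⟩, rfl⟩, by rintro ⟨z, rfl⟩; exact z.2⟩)
      (Submodule.inclusion_injective h) (Submodule.mkQ_surjective _)
  · exact fun a b hab ha => Module.mem_support_mono hab ha
  · exact fun a b hab ha => Module.mem_support_mono hab ha

lemma mDim_sup (A B : Submodule R M) : mDim R ↥(A ⊔ B) ≤ max (mDim R A) (mDim R B) := by
  refine (mDim_le_max (le_sup_left : A ≤ A ⊔ B)).trans (max_le_max le_rfl ?_)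
  refine Module.supportDim_le_of_surjective
    ((Submodule.mkQ _).comp (Submodule.inclusion (le_sup_right : B ≤ A ⊔ B))) ?_
  intro y
  obtain ⟨⟨y, hy⟩, rfl⟩ := Submodule.mkQ_surjective _ y
  obtain ⟨a, ha, b, hb, rfl⟩ := Submodule.mem_sup.mp hy
  refine ⟨⟨b, hb⟩, ?_⟩
  rw [LinearMap.comp_apply, Submodule.mkQ_apply, Submodule.mkQ_apply, Submodule.Quotient.eq]
  simpa using ha

lemma mDim_bot : mDim R (⊥ : Submodule R M) = ⊥ :=
  Module.supportDim_eq_bot_of_subsingleton R _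

lemma mDim_deltaSub [IsNoetherian R M] (c : ℕ) : mDim R (deltaSub R M c) ≤ (c : WithBot ℕ∞) := by
  have h := (CompleteLattice.WellFoundedGT.isSupClosedCompact (Submodule R M) inferInstance)
    {N : Submodule R M | mDim R ↥N ≤ (c : WithBot ℕ∞)}
    ⟨⊥, by simp [mDim_bot]⟩
    (fun A hA B hB => (mDim_sup A B).trans (max_le hA hB))
  exact h

lemma lt_succ_cast (a : WithBot ℕ∞) (c : ℕ) : a < ((c + 1 : ℕ) : WithBot ℕ∞) ↔ a ≤ (c : WithBot ℕ∞) := by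
  induction a with
  | bot => simp
  | coe a =>
    induction a with
    | top =>
      constructor
      · intro h
        exact absurd (WithBot.coe_lt_coe.mp (show ((⊤ : ℕ∞) : WithBot ℕ∞) < (((c + 1 : ℕ) : ℕ∞) : WithBot ℕ∞) from h)) (by simp)
      · intro h
        exact absurd (WithBot.coe_le_coe.mp (show ((⊤ : ℕ∞) : WithBot ℕ∞) ≤ ((c : ℕ∞) : WithBot ℕ∞) from h)) (by simp)
    | coe a =>
      change ((a : ℕ) : WithBot ℕ∞) < _ ↔ ((a : ℕ) : WithBot ℕ∞) ≤ _
      rw [Nat.cast_lt, Nat.cast_le]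
      omega

lemma le_D [IsNoetherian R M] (c : ℕ) (N : Submodule R M) :
    N ≤ deltaSubPred R M c ↔ mDim R N < (c : WithBot ℕ∞) := by
  cases c with
  | zero =>
    rw [deltaSubPred, le_bot_iff]
    constructor
    · rintro rfl
      rw [mDim_bot]; exact WithBot.bot_lt_coe _
    · intro h
      by_contra hN
      have : Nontrivial N := Submodule.nontrivial_iff_ne_bot.mpr hN
      obtain ⟨a, ha⟩ := WithBot.ne_bot_iff_exists.mp (Module.supportDim_ne_bot_of_nontrivial R N)
      change Module.supportDim R N < _ at h
      rw [← ha] at h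
      have := WithBot.coe_lt_coe.mp (show (a : WithBot ℕ∞) < (((0 : ℕ) : ℕ∞) : WithBot ℕ∞) from h)
      simp at this
  | succ c =>
    rw [deltaSubPred, lt_succ_cast]
    exact ⟨fun h => (mDim_mono h).trans (mDim_deltaSub c), fun h => le_sSup h⟩

lemma D_mono [IsNoetherian R M] {a b : ℕ} (h : a ≤ b) : deltaSubPred R M a ≤ deltaSubPred R M b := by
  rw [le_D]
  exact ((le_D a _).mp le_rfl).trans_le (by exact_mod_cast h)

variable [IsNoetherianRing R] [IsLocalRing R] [Module.Finite R M]

lemma aux_step (A B N : Submodule R M) (h : IsCM R (maximalIdeal R) (subQuot R A B)) (hN : N ≤ B)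
    (hd : mDim R N < qd A B) : N ≤ A := by
  let φ : N →ₗ[R] subQuot R A B := (Submodule.mkQ _).comp (Submodule.inclusion hN)
  have h0 : LinearMap.range φ = ⊥ := by
    by_contra hcon
    have h1 := aux_cm _ h _ hcon
    have h2 : mDim R (LinearMap.range φ) ≤ mDim R N :=
      Module.supportDim_le_of_surjective φ.rangeRestrict φ.surjective_rangeRestrict
    exact absurd hd (not_lt.mpr (h1.trans h2))
  rw [LinearMap.range_eq_bot] at h0
  intro x hx
  have := LinearMap.congr_fun h0 ⟨x, hx⟩
  simpa [φ] using this

lemma qd_nat {A B : Submodule R M} (h : IsCM R (maximalIdeal R) (subQuot R A B)) (d : ℕ)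
    (hd : mDim R M = (d : WithBot ℕ∞)) : ∃ n : ℕ, qd A B = n := by
  have := h.1
  obtain ⟨a, ha⟩ := WithBot.ne_bot_iff_exists.mp
    (Module.supportDim_ne_bot_of_nontrivial R (subQuot R A B))
  have h2 : mDim R B ≤ mDim R M :=
    Module.supportDim_le_of_injective B.subtype B.injective_subtype
  have h3 := (qd_le A B).trans (h2.trans hd.le)
  change Module.supportDim R (subQuot R A B) ≤ _ at h3
  rw [← ha] at h3
  have h4 := WithBot.coe_le_coe.mp (show (a : WithBot ℕ∞) ≤ ((d : ℕ∞) : WithBot ℕ∞) from h3)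
  lift a to ℕ using (ne_top_of_le_ne_top (by simp) h4)
  exact ⟨a, ha.symm⟩

/-- natural number form of an sCM filtration -/
structure Fil (r : ℕ) (F : ℕ → Submodule R M) (f : ℕ → ℕ) : Prop where
  zero : F 0 = ⊥
  top : F r = ⊤
  lt : ∀ i < r, F i < F (i + 1)
  cm : ∀ i < r, IsCM R (maximalIdeal R) (subQuot R (F i) (F (i + 1)))
  dim : ∀ i < r, qd (F i) (F (i + 1)) = (f i : WithBot ℕ∞)
  mono : ∀ i j, i < j → j < r → f i < f j

lemma IsSCMFil.fil {r : ℕ} {F : ℕ → Submodule R M} (h : IsSCMFil R (maximalIdeal R) r F) (d : ℕ)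
    (hd : mDim R M = (d : WithBot ℕ∞)) : ∃ f, Fil r F f := by
  obtain ⟨h0, h1, h2, h3, h4⟩ := h
  have : ∀ i, ∃ n : ℕ, i < r → qd (F i) (F (i + 1)) = (n : WithBot ℕ∞) := by
    intro i
    by_cases hi : i < r
    · obtain ⟨n, hn⟩ := qd_nat (h3 i hi) d hd
      exact ⟨n, fun _ => hn⟩
    · exact ⟨0, fun h => absurd h hi⟩
  choose f hf using this
  refine ⟨f, h0, h1, h2, h3, hf, ?_⟩
  intro i j hij
  induction j, hij using Nat.le_induction with
  | base =>
    intro hj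
    have := h4 i hj
    change qd _ _ < qd _ _ at this
    rw [hf i (by omega), hf (i + 1) hj] at this
    exact_mod_cast this
  | succ j hij ih =>
    intro hj
    have := h4 j hj
    change qd _ _ < qd _ _ at this
    rw [hf j (by omega), hf (j + 1) hj] at this
    have h' : f j < f (j + 1) := by exact_mod_cast this
    exact (ih (by omega)).trans h'

lemma Fil.D_eq {r : ℕ} {F : ℕ → Submodule R M} {f : ℕ → ℕ} (h : Fil r F f) (c i : ℕ) (hi : i ≤ r)
    (h1 : ∀ j < i, f j < c) (h2 : ∀ j, i ≤ j → j < r → c ≤ f j) : deltaSubPred R M c = F i := by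
  apply le_antisymm
  · have : ∀ k, k ≤ r - i → deltaSubPred R M c ≤ F (r - k) := by
      intro k
      induction k with
      | zero => intro _; simp [h.top]
      | succ k ih =>
        intro hk
        have h3 := ih (by omega)
        have e : r - k = (r - (k + 1)) + 1 := by omega
        rw [e] at h3
        refine aux_step _ _ _ (h.cm (r - (k + 1)) (by omega)) h3 ?_
        rw [h.dim _ (by omega)]
        refine ((le_D c _).mp le_rfl).trans_le ?_
        exact_mod_cast h2 (r - (k + 1)) (by omega) (by omega)
    have h3 := this (r - i) le_rfl
    rwa [show r - (r - i) = i by omega] at h3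
  · have : ∀ k ≤ i, mDim R (F k) < (c : WithBot ℕ∞) := by
      intro k
      induction k with
      | zero =>
        intro _
        rw [h.zero, mDim_bot]; exact WithBot.bot_lt_coe _
      | succ k ih =>
        intro hk
        refine (mDim_le_max (h.lt k (by omega)).le).trans_lt (max_lt (ih (by omega)) ?_)
        rw [h.dim k (by omega)]
        exact_mod_cast h1 k (by omega)
    exact (le_D c _).mpr (this i le_rfl)

lemma Fil.D_eq' {r : ℕ} {F : ℕ → Submodule R M} {f : ℕ → ℕ} (h : Fil r F f) (i : ℕ) (hi : i < r) :
    deltaSubPred R M (f i) = F i := by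
  refine h.D_eq _ _ hi.le (fun j hj => h.mono j i hj hi) (fun j hj hjr => ?_)
  rcases hj.eq_or_lt with rfl | hj
  · exact le_rfl
  · exact (h.mono i j hj hjr).le

lemma Fil.D_succ {r : ℕ} {F : ℕ → Submodule R M} {f : ℕ → ℕ} (h : Fil r F f) (i : ℕ) (hi : i < r) :
    deltaSubPred R M (f i + 1) = F (i + 1) := by
  refine h.D_eq _ _ hi (fun j hj => ?_) (fun j hj hjr => h.mono i j hj hjr)
  rcases (Nat.lt_succ_iff.mp hj).eq_or_lt with rfl | hj
  · exact Nat.lt_succ_self _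
  · exact (h.mono j i hj hi).trans (Nat.lt_succ_self _)

lemma Fil.exists_idx {r : ℕ} {F : ℕ → Submodule R M} {f : ℕ → ℕ} (h : Fil r F f) (c : ℕ) :
    ∃ i ≤ r, (∀ j < i, f j < c) ∧ (∀ j, i ≤ j → j < r → c ≤ f j) := by
  classical
  have hex : ∃ i, i = r ∨ c ≤ f i := ⟨r, Or.inl rfl⟩
  refine ⟨Nat.find hex, Nat.find_min' hex (Or.inl rfl), fun j hj => ?_, fun j hj hjr => ?_⟩
  · have := Nat.find_min hex hj
    push Not at this
    exact this.2
  · rcases Nat.find_spec hex with h1 | h1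
    · omega
    · rcases hj.eq_or_lt with h2 | h2
      · rwa [h2] at h1
      · exact h1.trans (h.mono _ j h2 hjr).le

lemma Fil.uniq_aux {r r' : ℕ} {F F' : ℕ → Submodule R M} {f f' : ℕ → ℕ} (h : Fil r F f)
    (h' : Fil r' F' f') : ∀ i ≤ r, i ≤ r' ∧ F i = F' i := by
  intro i
  induction i with
  | zero => intro _; exact ⟨Nat.zero_le _, by rw [h.zero, h'.zero]⟩
  | succ i ih =>
    intro hi
    obtain ⟨h1, h2⟩ := ih (by omega)
    have hlt := h.lt i hi
    have hi' : i < r' := by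
      by_contra hcon
      have : i = r' := by omega
      rw [h2, this, h'.top] at hlt
      exact not_top_lt hlt
    have hlt' := h'.lt i hi'
    have e1 := h.D_eq' i hi
    have e2 := h'.D_eq' i hi'
    have e3 := h.D_succ i hi
    have e4 := h'.D_succ i hi'
    have : f i = f' i := by
      rcases lt_trichotomy (f i) (f' i) with hh | hh | hh
      · have := D_mono (R := R) (M := M) (Nat.succ_le_of_lt hh)
        rw [Nat.succ_eq_add_one, e3, e2, ← h2] at this
        exact absurd hlt (not_lt_of_ge this)
      · exact hh
      · have := D_mono (R := R) (M := M) (Nat.succ_le_of_lt hh)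
        rw [Nat.succ_eq_add_one, e4, e1, h2] at this
        exact absurd hlt' (not_lt_of_ge this)
    exact ⟨hi', by rw [← e3, ← e4, this]⟩

lemma Fil.filtered {r : ℕ} {F : ℕ → Submodule R M} {f : ℕ → ℕ} (h : Fil r F f) (c : ℕ) :
    Subsingleton (subQuot R (deltaSubPred R M c) (deltaSubPred R M (c + 1))) ∨
      IsCM R (maximalIdeal R) (subQuot R (deltaSubPred R M c) (deltaSubPred R M (c + 1))) := by
  obtain ⟨i, hi, a1, a2⟩ := h.exists_idx c
  obtain ⟨k, hk, b1, b2⟩ := h.exists_idx (c + 1)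
  rw [h.D_eq c i hi a1 a2, h.D_eq (c + 1) k hk b1 b2]
  have hki : k ≤ i + 1 := by
    by_contra hcon
    have c1 := a2 i le_rfl (by omega)
    have c2 := h.mono i (i + 1) (by omega) (by omega)
    have c3 := b1 (i + 1) (by omega)
    omega
  have hik : i ≤ k := by
    by_contra hcon
    have c1 := a1 k (by omega)
    have c2 := b2 k le_rfl (by omega)
    omega
  rcases hik.eq_or_lt with e | e
  · left
    subst e
    rw [Submodule.Quotient.subsingleton_iff]
    exact Submodule.comap_subtype_self _
  · right
    obtain rfl : k = i + 1 := by omega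
    exact h.cm i (by omega)

lemma aux_build (c : ℕ) (h : ∀ i < c, 
    Subsingleton (subQuot R (deltaSubPred R M i) (deltaSubPred R M (i + 1))) ∨
      IsCM R (maximalIdeal R) (subQuot R (deltaSubPred R M i) (deltaSubPred R M (i + 1)))) :
    ∃ (r : ℕ) (F : ℕ → Submodule R M), F 0 = ⊥ ∧ F r = deltaSubPred R M c ∧
      (∀ i < r, F i < F (i + 1)) ∧
      (∀ i < r, IsCM R (maximalIdeal R) (subQuot R (F i) (F (i + 1)))) ∧
      (∀ i, i + 1 < r → qd (F i) (F (i + 1)) < qd (F (i + 1)) (F (i + 2))) ∧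
      (∀ i < r, qd (F i) (F (i + 1)) < (c : WithBot ℕ∞)) := by
  induction c with
  | zero => exact ⟨0, fun _ => ⊥, rfl, rfl, by simp, by simp, by simp, by simp⟩
  | succ c ih =>
    obtain ⟨r, F, h0, h1, h2, h3, h4, h5⟩ := ih (fun i hi => h i (by omega))
    have hc : (c : WithBot ℕ∞) < ((c + 1 : ℕ) : WithBot ℕ∞) := by exact_mod_cast Nat.lt_succ_self c
    by_cases hle : deltaSubPred R M (c + 1) ≤ deltaSubPred R M c
    · exact ⟨r, F, h0, h1.trans (le_antisymm (D_mono (Nat.le_succ c)) hle), h2, h3, h4,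
        fun i hi => (h5 i hi).trans hc⟩
    · have hcm : IsCM R (maximalIdeal R)
          (subQuot R (deltaSubPred R M c) (deltaSubPred R M (c + 1))) := by
        refine (h c (Nat.lt_succ_self c)).resolve_left fun hs => hle ?_
        rw [Submodule.Quotient.subsingleton_iff] at hs
        exact Submodule.comap_subtype_eq_top.mp hs
      have hlow : (c : WithBot ℕ∞) ≤ qd (deltaSubPred R M c) (deltaSubPred R M (c + 1)) := by
        by_contra hcon
        rw [not_le] at hcon
        exact hle ((le_D c _).mpr ((mDim_le_max (D_mono (Nat.le_succ c))).trans_lt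
          (max_lt ((le_D c _).mp le_rfl) hcon)))
      have hup : qd (deltaSubPred R M c) (deltaSubPred R M (c + 1)) < ((c + 1 : ℕ) : WithBot ℕ∞) :=
        (qd_le _ _).trans_lt ((le_D _ _).mp le_rfl)
      let G : ℕ → Submodule R M := fun i => if i ≤ r then F i else deltaSubPred R M (c + 1)
      have g1 : ∀ i, i ≤ r → G i = F i := fun i hi => if_pos hi
      have g2 : G (r + 1) = deltaSubPred R M (c + 1) := if_neg (by omega)
      have g3 : G r = deltaSubPred R M c := (g1 r le_rfl).trans h1
      refine ⟨r + 1, G, (g1 0 (by omega)).trans h0, g2, ?_, ?_, ?_, ?_⟩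
      · intro i hi
        rcases (Nat.lt_succ_iff.mp hi).eq_or_lt with rfl | hi
        · rw [g3, g2]
          exact lt_of_le_not_ge (D_mono (Nat.le_succ c)) hle
        · rw [g1 i hi.le, g1 (i + 1) hi]; exact h2 i hi
      · intro i hi
        rcases (Nat.lt_succ_iff.mp hi).eq_or_lt with rfl | hi
        · rw [g3, g2]; exact hcm
        · rw [g1 i hi.le, g1 (i + 1) hi]; exact h3 i hi
      · intro i hi
        rcases (Nat.lt_succ_iff.mp hi).eq_or_lt with e | hi
        · have : G (i + 2) = deltaSubPred R M (c + 1) := by rw [← g2, ← e]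
          rw [this, g1 i (by omega), g1 (i + 1) e.le]
          have h6 := h5 i (by omega)
          have h7 : F (i + 1) = deltaSubPred R M c := by rw [← h1, ← e]
          rw [h7] at h6 ⊢
          exact h6.trans_le hlow
        · rw [g1 i (by omega), g1 (i + 1) (by omega), g1 (i + 2) hi]; exact h4 i hi
      · intro i hi
        rcases (Nat.lt_succ_iff.mp hi).eq_or_lt with rfl | hi
        · rw [g3, g2]; exact hup
        · rw [g1 i hi.le, g1 (i + 1) hi]; exact (h5 i hi).trans hc

end aux2

open IsLocalRing in
/-- (Schenzel)  Let `M` be a finitely generated module of dimension `d` over a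
Noetherian local ring `R`.  Then `M` is sequentially Cohen-Macaulay if and only if `M` is
Cohen-Macaulay filtered (each quotient `δ_i(M)/δ_{i-1}(M)` of the dimension filtration is
zero or Cohen-Macaulay); moreover the sCM filtration of a sequentially Cohen-Macaulay module
is unique. -/
theorem stmt7 (R : Type) [CommRing R] [IsNoetherianRing R] [IsLocalRing R]
    (M : Type) [AddCommGroup M] [Module R M] [Module.Finite R M]
    (d : ℕ) (hd : mDim R M = (d : WithBot ℕ∞)) :
    (IsSeqCM R (maximalIdeal R) M ↔
      ∀ i ≤ d,
        Subsingleton (subQuot R (deltaSubPred R M i) (deltaSub R M i)) ∨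
          IsCM R (maximalIdeal R) (subQuot R (deltaSubPred R M i) (deltaSub R M i))) ∧
    (∀ (r r' : ℕ) (F F' : ℕ → Submodule R M),
      IsSCMFil R (maximalIdeal R) r F → IsSCMFil R (maximalIdeal R) r' F' →
        r = r' ∧ ∀ i ≤ r, F i = F' i) := by
  refine ⟨⟨?_, ?_⟩, ?_⟩
  · rintro ⟨r, F, hF⟩ i _
    obtain ⟨f, hf⟩ := hF.fil d hd
    exact hf.filtered i
  · intro h
    obtain ⟨r, F, h0, h1, h2, h3, h4, -⟩ := aux_build (R := R) (M := M) (d + 1)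
      (fun i hi => h i (by omega))
    refine ⟨r, F, h0, h1.trans (top_le_iff.mp ((le_D _ _).mpr ?_)), h2, h3, h4⟩
    have h5 : mDim R (⊤ : Submodule R M) ≤ mDim R M :=
      Module.supportDim_le_of_injective (Submodule.subtype _) (Submodule.injective_subtype _)
    rw [lt_succ_cast]
    exact h5.trans hd.le
  · intro r r' F F' hF hF'
    obtain ⟨f, hf⟩ := hF.fil d hd
    obtain ⟨f', hf'⟩ := hF'.fil d hd
    exact ⟨le_antisymm (hf.uniq_aux hf' r le_rfl).1 (hf'.uniq_aux hf r' le_rfl).1,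
      fun i hi => (hf.uniq_aux hf' i hi).2⟩
end
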